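/- Let n ≥ 1 and let M = ℝ^{2n-2} × (0,1) × ℝ (an open subset of ℝ^{2n}, with (0,1) the x_n-coordinate and ℝ the y_n-coordinate). Let λ : ℝ^{2n-2} → ℝ be a lower semi-continuous function with 0 < λ(p) ≤ 1 for all p, and let Z = {(p, x, 0) ∈ M : λ(p) ≤ x} (a closed subset of M, the epigraph of λ times {0}). Then Z is time-independent Hamiltonian excisable from (M, ω_can): there exists a smooth F : M → ℝ such that every forward trajectory of the flow of X_F starting in Z stays in Z as long as it is defined, the maximal integral curve of X_F starting at any z ∈ M ∖ Z is defined at least on [0,1], and the time-1 flow map of X_F is a symplectomorphism from M ∖ Z onto M. -/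

import Mathlib

open Set

noncomputable section

/-- `ℝ^{2n}` presented as `(p, xₙ, yₙ)` with `p = (x₁,y₁,…,x_{n-1},y_{n-1}) ∈ ℝ^{2(n-1)}`;
here `m = n - 1`, so `n ≥ 1` corresponds to arbitrary `m : ℕ`. -/
abbrev EE (m : ℕ) := ((Fin m → ℝ) × (Fin m → ℝ)) × ℝ × ℝ

/-- The standard symplectic form on `ℝ^{2m}`. -/
def wB (m : ℕ) (u v : (Fin m → ℝ) × (Fin m → ℝ)) : ℝ :=
  ∑ i, (u.1 i * v.2 i - u.2 i * v.1 i)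

/-- The standard symplectic form `ω_can` on `ℝ^{2n} = ℝ^{2m} × ℝ × ℝ`. -/
def wcan (m : ℕ) (u v : EE m) : ℝ :=
  wB m u.1 v.1 + (u.2.1 * v.2.2 - u.2.2 * v.2.1)

/-- `M = ℝ^{2n-2} × (0,1) × ℝ`. -/
def Mset (m : ℕ) : Set (EE m) := {z | z.2.1 ∈ Ioo (0 : ℝ) 1}

section Nemytskii

open Filter Topology

variable {E G : Type} [NormedAddCommGroup E] [NormedSpace ℝ E]
  [NormedAddCommGroup G] [NormedSpace ℝ G]

/-- Pointwise application of a curve of linear maps to a curve of vectors, as a bounded bilinear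
map. -/
def pointwiseApply (E G : Type) [NormedAddCommGroup E] [NormedSpace ℝ E]
    [NormedAddCommGroup G] [NormedSpace ℝ G] :
    C(Icc (0 : ℝ) 1, E →L[ℝ] G) →L[ℝ] C(Icc (0 : ℝ) 1, E) →L[ℝ] C(Icc (0 : ℝ) 1, G) :=
  LinearMap.mkContinuous₂ (E := C(Icc (0 : ℝ) 1, E →L[ℝ] G)) (F := C(Icc (0 : ℝ) 1, E))
    (G := C(Icc (0 : ℝ) 1, G))
    (LinearMap.mk₂ ℝ (fun (A : C(Icc (0 : ℝ) 1, E →L[ℝ] G)) (h : C(Icc (0 : ℝ) 1, E)) =>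
      (⟨fun t => A t (h t), by fun_prop⟩ : C(Icc (0 : ℝ) 1, G)))
      (fun _ _ _ => by ext; simp) (fun _ _ _ => by ext; simp)
      (fun _ _ _ => by ext; simp) (fun _ _ _ => by ext; simp)) 1
    (fun A h => by
      refine (ContinuousMap.norm_le _ (by positivity)).2 fun t => ?_
      rw [one_mul]
      exact ((A t).le_opNorm (h t)).trans
        (mul_le_mul (A.norm_coe_le_norm t) (h.norm_coe_le_norm t) (norm_nonneg _) (norm_nonneg A)))

@[simp] lemma pointwiseApply_apply (A : C(Icc (0 : ℝ) 1, E →L[ℝ] G)) (h : C(Icc (0 : ℝ) 1, E))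
    (t : Icc (0 : ℝ) 1) : pointwiseApply E G A h t = A t (h t) := rfl

lemma norm_pointwiseApply_le (A : C(Icc (0 : ℝ) 1, E →L[ℝ] G)) :
    ‖pointwiseApply E G A‖ ≤ ‖A‖ := by
  refine ContinuousLinearMap.opNorm_le_bound _ (norm_nonneg A) fun h => ?_
  refine (ContinuousMap.norm_le _ (by positivity)).2 fun t => ?_
  exact ((A t).le_opNorm (h t)).trans
    (mul_le_mul (A.norm_coe_le_norm t) (h.norm_coe_le_norm t) (norm_nonneg _) (norm_nonneg A))

lemma exists_norm_taylor_le {g : E → G} (hg : ContDiff ℝ (⊤ : ℕ∞) g)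
    (hc : HasCompactSupport g) :
    ∃ C : ℝ, 0 ≤ C ∧ ∀ a b, ‖g b - g a - fderiv ℝ g a (b - a)‖ ≤ C * ‖b - a‖ ^ 2 := by
  have h1 : ContDiff ℝ (⊤ : ℕ∞) (fderiv ℝ g) := hg.fderiv_right (by simp)
  obtain ⟨C, hC⟩ := h1.lipschitzWith_of_hasCompactSupport (hc.fderiv (𝕜 := ℝ)) (by simp)
  refine ⟨C, C.2, fun a b => ?_⟩
  have h := (convex_segment a b).norm_image_sub_le_of_norm_fderiv_le' (𝕜 := ℝ) (f := g)
    (φ := fderiv ℝ g a) (C := C * ‖b - a‖)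
    (fun x _ => (hg.differentiable (by simp)).differentiableAt) (fun x hx => ?_)
    (left_mem_segment ℝ a b) (right_mem_segment ℝ a b)
  · rwa [mul_assoc, ← pow_two] at h
  · refine (hC.norm_sub_le x a).trans ?_
    gcongr
    obtain ⟨s, ⟨hs0, hs1⟩, rfl⟩ := (segment_eq_image' ℝ a b ▸ hx : x ∈ _)
    simp only [add_sub_cancel_left, norm_smul, Real.norm_eq_abs, abs_of_nonneg hs0]
    exact mul_le_of_le_one_left (norm_nonneg _) hs1

/-- Composition with a fixed continuous map, as an operator on curves. -/
def nemytskii {E G : Type} [TopologicalSpace E] [TopologicalSpace G] (g : C(E, G))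
    (γ : C(Icc (0 : ℝ) 1, E)) : C(Icc (0 : ℝ) 1, G) := g.comp γ

@[simp] lemma nemytskii_apply {E G : Type} [TopologicalSpace E] [TopologicalSpace G] (g : C(E, G))
    (γ : C(Icc (0 : ℝ) 1, E)) (t : Icc (0 : ℝ) 1) :
    nemytskii g γ t = g (γ t) := rfl

lemma hasFDerivAt_nemytskii {g : C(E, G)} (hg : ContDiff ℝ (⊤ : ℕ∞) g)
    (hc : HasCompactSupport g) (γ : C(Icc (0 : ℝ) 1, E)) :
    HasFDerivAt (nemytskii g)
      (pointwiseApply E G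
        (nemytskii ⟨fderiv ℝ g, hg.continuous_fderiv (by simp)⟩ γ)) γ := by
  obtain ⟨C, hC0, hC⟩ := exists_norm_taylor_le hg hc
  refine .of_isLittleO ?_
  have h2 : (fun x : C(Icc (0 : ℝ) 1, E) => ‖x - γ‖ ^ 2) =o[𝓝 γ] fun x => x - γ := by
    have : (fun x : C(Icc (0 : ℝ) 1, E) => ‖x‖ ^ 2) =o[𝓝 0] fun x => x := by
      simpa using (Asymptotics.isLittleO_norm_pow_id (E' := C(Icc (0 : ℝ) 1, E)) one_lt_two)
    have ht : Tendsto (fun x : C(Icc (0 : ℝ) 1, E) => x - γ) (𝓝 γ) (𝓝 0) := by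
      have : Continuous fun x : C(Icc (0 : ℝ) 1, E) => x - γ := by fun_prop
      simpa using this.tendsto γ
    exact this.comp_tendsto ht
  refine Asymptotics.IsBigO.trans_isLittleO (.of_bound C (.of_forall fun x => ?_)) h2
  refine (ContinuousMap.norm_le _ (by positivity)).2 fun t => ?_
  refine (hC (γ t) (x t)).trans ?_
  rw [Real.norm_of_nonneg (by positivity)]
  gcongr
  exact (x - γ).norm_coe_le_norm t

lemma contDiff_nat_nemytskii (n : ℕ) : ∀ {G : Type} [NormedAddCommGroup G] [NormedSpace ℝ G]
    {g : C(E, G)}, ContDiff ℝ (⊤ : ℕ∞) g → HasCompactSupport g →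
    ContDiff ℝ n (nemytskii g) := by
  induction n with
  | zero =>
    intro G _ _ g _ _
    exact contDiff_zero.2 (ContinuousMap.continuous_postcomp g)
  | succ n ih =>
    intro G _ _ g hg hc
    refine contDiff_succ_iff_hasFDerivAt.2 ⟨_, ?_, hasFDerivAt_nemytskii hg hc⟩
    have hp : ContDiff ℝ n (pointwiseApply E G) := by fun_prop
    refine hp.comp (ih ?_ ?_)
    · exact hg.fderiv_right (by simp)
    · exact hc.fderiv (𝕜 := ℝ)

lemma contDiff_nemytskii {g : C(E, G)} (hg : ContDiff ℝ (⊤ : ℕ∞) g) (hc : HasCompactSupport g) :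
    ContDiff ℝ (⊤ : ℕ∞) (nemytskii g) :=
  contDiff_infty.2 fun n => contDiff_nat_nemytskii n hg hc

end Nemytskii

section Primitive

variable {E : Type} [NormedAddCommGroup E]

/-- Extension of a curve on `[0, 1]` to the line, constant outside `[0, 1]`. -/
def extendCurve (γ : C(Icc (0 : ℝ) 1, E)) (t : ℝ) : E := γ (projIcc 0 1 zero_le_one t)

lemma continuous_extendCurve (γ : C(Icc (0 : ℝ) 1, E)) : Continuous (extendCurve γ) :=
  γ.continuous.comp continuous_projIcc

lemma norm_extendCurve_le (γ : C(Icc (0 : ℝ) 1, E)) (t : ℝ) : ‖extendCurve γ t‖ ≤ ‖γ‖ :=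
  γ.norm_coe_le_norm _

lemma extendCurve_of_mem (γ : C(Icc (0 : ℝ) 1, E)) {t : ℝ} (ht : t ∈ Icc (0 : ℝ) 1) :
    extendCurve γ t = γ ⟨t, ht⟩ := by
  rw [extendCurve, projIcc_of_mem]

variable [NormedSpace ℝ E]

/-- The primitive of a curve vanishing at time `0`, as a bounded operator. -/
def primitiveCLM (E : Type) [NormedAddCommGroup E] [NormedSpace ℝ E] :
    C(Icc (0 : ℝ) 1, E) →L[ℝ] C(Icc (0 : ℝ) 1, E) :=
  LinearMap.mkContinuous
    { toFun := fun γ => ⟨fun t => ∫ s in (0 : ℝ)..t, extendCurve γ s,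
        (intervalIntegral.continuous_primitive
          (fun a b => (continuous_extendCurve γ).intervalIntegrable a b) 0).comp
          continuous_subtype_val⟩
      map_add' := fun γ δ => by
        ext t
        exact intervalIntegral.integral_add ((continuous_extendCurve γ).intervalIntegrable _ _)
          ((continuous_extendCurve δ).intervalIntegrable _ _)
      map_smul' := fun c γ => by
        ext t
        exact intervalIntegral.integral_smul c (extendCurve γ) } 1
    (fun γ => by
      refine (ContinuousMap.norm_le _ (by positivity)).2 fun t => ?_
      refine (intervalIntegral.norm_integral_le_of_norm_le_const
        (fun s _ => norm_extendCurve_le γ s)).trans ?_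
      rw [sub_zero, abs_of_nonneg t.2.1, mul_comm]
      exact mul_le_mul_of_nonneg_right t.2.2 (norm_nonneg _))

lemma norm_primitiveCLM_le : ‖primitiveCLM E‖ ≤ 1 :=
  LinearMap.mkContinuous_norm_le _ zero_le_one _

/-- A curve solving an integral equation extends to a differentiable curve on the line. -/
lemma exists_hasDerivAt_of_eq_add_primitiveCLM [CompleteSpace E] {γ δ : C(Icc (0 : ℝ) 1, E)}
    {z : E} (h : ∀ t, γ t = z + primitiveCLM E δ t) :
    ∃ c : ℝ → E, c 0 = z ∧ (∀ t : Icc (0 : ℝ) 1, c t = γ t) ∧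
      ∀ t : Icc (0 : ℝ) 1, HasDerivAt c (δ t) t := by
  refine ⟨fun t => z + ∫ s in (0 : ℝ)..t, extendCurve δ s, by simp, fun t => (h t).symm,
    fun t => ?_⟩
  have h := ((continuous_extendCurve δ).integral_hasStrictDerivAt 0 (t : ℝ)).hasDerivAt
  rw [extendCurve_of_mem δ t.2] at h
  exact h.const_add z

end Primitive

section SmallFlow

open Filter Topology

variable {E : Type} [NormedAddCommGroup E] [NormedSpace ℝ E]

/-- The constant curve, as a bounded operator. -/
def constCurveCLM (E : Type) [NormedAddCommGroup E] [NormedSpace ℝ E] :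
    E →L[ℝ] C(Icc (0 : ℝ) 1, E) :=
  LinearMap.mkContinuous
    { toFun := fun z => ContinuousMap.const _ z
      map_add' := fun _ _ => rfl
      map_smul' := fun _ _ => rfl } 1
    (fun z => by
      refine (ContinuousMap.norm_le _ (by positivity)).2 fun t => ?_
      rw [one_mul]; exact le_rfl)

@[simp] lemma constCurveCLM_apply (z : E) (t : Icc (0 : ℝ) 1) : constCurveCLM E z t = z := rfl

lemma eqOn_Icc_of_hasDerivAt {Y : E → E} {K : NNReal} (hK : LipschitzWith K Y) {c d : ℝ → E}
    {T : ℝ} (hc : ∀ t ∈ Icc 0 T, HasDerivAt c (Y (c t)) t)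
    (hd : ∀ t ∈ Icc 0 T, HasDerivAt d (Y (d t)) t) (h : c 0 = d 0) : EqOn c d (Icc 0 T) :=
  ODE_solution_unique (v := fun _ => Y) (fun _ => hK)
    (fun t ht => (hc t ht).continuousAt.continuousWithinAt)
    (fun t ht => (hc t (Ico_subset_Icc_self ht)).hasDerivWithinAt)
    (fun t ht => (hd t ht).continuousAt.continuousWithinAt)
    (fun t ht => (hd t (Ico_subset_Icc_self ht)).hasDerivWithinAt) h

lemma norm_primitive_comp_pointwiseApply_lt_one {Y : C(E, E)} (hY : ContDiff ℝ (⊤ : ℕ∞) Y)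
    {K : NNReal} (hK : LipschitzWith K Y) (hK1 : K < 1) (γ : C(Icc (0 : ℝ) 1, E)) :
    ‖(primitiveCLM E).comp (pointwiseApply E E
        (nemytskii ⟨fderiv ℝ Y, hY.continuous_fderiv (by simp)⟩ γ))‖ < 1 := by
  refine lt_of_le_of_lt ?_ (NNReal.coe_lt_one.2 hK1)
  refine (ContinuousLinearMap.opNorm_comp_le _ _).trans ?_
  refine (mul_le_mul norm_primitiveCLM_le (norm_pointwiseApply_le _)
    (norm_nonneg (pointwiseApply E E _))
    zero_le_one).trans ?_
  rw [one_mul]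
  exact (ContinuousMap.norm_le _ K.2).2 fun t => norm_fderiv_le_of_lipschitz ℝ hK

theorem exists_curve_family [CompleteSpace E] {Y : C(E, E)}
    (hY : ContDiff ℝ (⊤ : ℕ∞) Y) (hcs : HasCompactSupport Y)
    {K : NNReal} (hK : LipschitzWith K Y) (hK1 : K < 1) {c : ℝ → E}
    (hc : ∀ t ∈ Icc (0 : ℝ) 1, HasDerivAt c (Y (c t)) t) :
    ∃ Γ : E → C(Icc (0 : ℝ) 1, E), ContDiffAt ℝ (⊤ : ℕ∞) Γ (c 0) ∧
      (∀ t, Γ (c 0) t = c t) ∧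
      ∀ᶠ z in 𝓝 (c 0), Γ z - primitiveCLM E (nemytskii Y (Γ z)) = constCurveCLM E z := by
  let γ₀ : C(Icc (0 : ℝ) 1, E) := ⟨fun t => c t, continuous_iff_continuousAt.2 fun t =>
    (hc t t.2).continuousAt.comp continuous_subtype_val.continuousAt⟩
  let S : C(Icc (0 : ℝ) 1, E) → C(Icc (0 : ℝ) 1, E) := fun γ =>
    γ - primitiveCLM E (nemytskii Y γ)
  have hS0 : S γ₀ = constCurveCLM E (c 0) := by
    ext t
    have h01 : uIcc (0 : ℝ) t ⊆ Icc 0 1 := by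
      rw [uIcc_of_le t.2.1]; exact Icc_subset_Icc_right t.2.2
    have he : ∀ s ∈ uIcc (0 : ℝ) t, extendCurve (nemytskii Y γ₀) s = Y (c s) := fun s hs => by
      rw [extendCurve_of_mem _ (h01 hs)]; rfl
    have := intervalIntegral.integral_eq_sub_of_hasDerivAt (f := c)
      (f' := fun s => Y (c s)) (a := 0) (b := t) (fun s hs => hc s (h01 hs))
      (ContinuousOn.intervalIntegrable fun s hs =>
        (Y.continuous.continuousAt.comp (hc s (h01 hs)).continuousAt).continuousWithinAt)
    change c t - ∫ s in (0 : ℝ)..t, extendCurve (nemytskii Y γ₀) s = c 0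
    rw [intervalIntegral.integral_congr he, this]
    abel
  have hSd : ContDiff ℝ (⊤ : ℕ∞) S := by
    have h1 := contDiff_nemytskii hY hcs
    have h2 : ContDiff ℝ (⊤ : ℕ∞) (primitiveCLM E) := by fun_prop
    exact contDiff_id.sub (h2.comp h1)
  let A := (primitiveCLM E).comp (pointwiseApply E E
        (nemytskii ⟨fderiv ℝ Y, hY.continuous_fderiv (by simp)⟩ γ₀))
  have hA : ‖A‖ < 1 := norm_primitive_comp_pointwiseApply_lt_one hY hK hK1 γ₀
  let e : C(Icc (0 : ℝ) 1, E) ≃L[ℝ] C(Icc (0 : ℝ) 1, E) :=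
    ContinuousLinearEquiv.ofUnit (Units.oneSub A hA)
  have hSf : HasFDerivAt S (e : C(Icc (0 : ℝ) 1, E) →L[ℝ] C(Icc (0 : ℝ) 1, E)) γ₀ :=
    (hasFDerivAt_id γ₀).sub ((primitiveCLM E).hasFDerivAt.comp γ₀ (hasFDerivAt_nemytskii hY hcs γ₀))
  have hn : ((⊤ : ℕ∞) : WithTop ℕ∞) ≠ 0 := by simp
  have hSs : HasStrictFDerivAt S (e : C(Icc (0 : ℝ) 1, E) →L[ℝ] C(Icc (0 : ℝ) 1, E)) γ₀ :=
    hSd.contDiffAt.hasStrictFDerivAt' hSf hn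
  refine ⟨fun z => hSd.contDiffAt.localInverse hSf hn (constCurveCLM E z), ?_, fun t => ?_, ?_⟩
  · have h1 := hSd.contDiffAt.to_localInverse hSf hn
    have h2 : ContDiff ℝ (⊤ : ℕ∞) (constCurveCLM E) := by fun_prop
    rw [hS0] at h1
    exact h1.comp _ h2.contDiffAt
  · beta_reduce
    rw [← hS0, hSd.contDiffAt.localInverse_apply_image]
    rfl
  · have h1 := hSs.eventually_right_inverse
    rw [hS0] at h1
    exact (constCurveCLM E).continuous.continuousAt.eventually h1

theorem contDiffAt_timeOne_of_small [CompleteSpace E] {Y : C(E, E)}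
    (hY : ContDiff ℝ (⊤ : ℕ∞) Y) (hcs : HasCompactSupport Y)
    {K : NNReal} (hK : LipschitzWith K Y) (hK1 : K < 1) {Φ : E → E}
    (hΦ : ∀ z, ∃ c : ℝ → E, c 0 = z ∧ (∀ t ∈ Icc (0 : ℝ) 1, HasDerivAt c (Y (c t)) t) ∧
      c 1 = Φ z) (z₀ : E) :
    ContDiffAt ℝ (⊤ : ℕ∞) Φ z₀ ∧ ∀ B : E →L[ℝ] E →L[ℝ] ℝ,
      (∀ x a b, B (fderiv ℝ Y x a) b + B a (fderiv ℝ Y x b) = 0) →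
      ∀ u v, B (fderiv ℝ Φ z₀ u) (fderiv ℝ Φ z₀ v) = B u v := by
  obtain ⟨c, rfl, hc, hc1⟩ := hΦ z₀
  obtain ⟨Γ, hΓ, hΓ0, hΓe⟩ := exists_curve_family hY hcs hK hK1 hc
  have h1 : (1 : ℝ) ∈ Icc (0 : ℝ) 1 := by simp
  let ev : C(Icc (0 : ℝ) 1, E) →L[ℝ] E := ContinuousMap.evalCLM ℝ ⟨1, h1⟩
  have hev : Φ =ᶠ[𝓝 (c 0)] fun z => ev (Γ z) := by
    filter_upwards [hΓe] with z hz
    obtain ⟨d, hd0, hd, hd1⟩ := hΦ z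
    obtain ⟨d', hd'0, hd'Γ, hd'⟩ := exists_hasDerivAt_of_eq_add_primitiveCLM
      (γ := Γ z) (δ := nemytskii Y (Γ z)) (z := z) (fun t => by
        have := congrArg (fun γ : C(Icc (0 : ℝ) 1, E) => γ t) hz
        simp only [ContinuousMap.sub_apply, constCurveCLM_apply] at this
        exact sub_eq_iff_eq_add.1 this)
    have := eqOn_Icc_of_hasDerivAt hK hd (d := d') (fun t ht => by
      have := hd' ⟨t, ht⟩
      rwa [nemytskii_apply, ← hd'Γ] at this) (hd0.trans hd'0.symm) h1
    rw [← hd1, this]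
    exact hd'Γ ⟨1, h1⟩
  refine ⟨?_, fun B hB u v => ?_⟩
  · have h2 : ContDiff ℝ (⊤ : ℕ∞) ev := by fun_prop
    exact (h2.contDiffAt.comp _ hΓ).congr_of_eventuallyEq hev
  have hΓd : HasFDerivAt Γ (fderiv ℝ Γ (c 0)) (c 0) :=
    (hΓ.differentiableAt (by simp)).hasFDerivAt
  have hΦd : ∀ u, fderiv ℝ Φ (c 0) u = ev (fderiv ℝ Γ (c 0) u) := fun u => by
    have : HasFDerivAt Φ (ev.comp (fderiv ℝ Γ (c 0))) (c 0) :=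
      (ev.hasFDerivAt.comp _ hΓd).congr_of_eventuallyEq hev
    rw [this.fderiv]; rfl
  have hvar : ∀ u, fderiv ℝ Γ (c 0) u - primitiveCLM E (pointwiseApply E E
        (nemytskii ⟨fderiv ℝ Y, hY.continuous_fderiv (by simp)⟩ (Γ (c 0))) (fderiv ℝ Γ (c 0) u)) =
        constCurveCLM E u := fun u => by
    have h3 := hΓd.sub ((primitiveCLM E).hasFDerivAt.comp _
      ((hasFDerivAt_nemytskii hY hcs (Γ (c 0))).comp _ hΓd))
    have h4 : HasFDerivAt (constCurveCLM E) (constCurveCLM E) (c 0) :=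
      (constCurveCLM E).hasFDerivAt
    have h5 := (h4.congr_of_eventuallyEq hΓe).unique h3
    rw [h5]
    rfl
  have hcurve : ∀ u, ∃ w : ℝ → E, w 0 = u ∧ w 1 = fderiv ℝ Φ (c 0) u ∧
      ∀ t ∈ Icc (0 : ℝ) 1, HasDerivAt w (fderiv ℝ Y (c t) (w t)) t := fun u => by
    obtain ⟨w, hw0, hwΓ, hw⟩ := exists_hasDerivAt_of_eq_add_primitiveCLM
      (γ := fderiv ℝ Γ (c 0) u) (δ := pointwiseApply E E
        (nemytskii ⟨fderiv ℝ Y, hY.continuous_fderiv (by simp)⟩ (Γ (c 0))) (fderiv ℝ Γ (c 0) u))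
      (z := u) (fun t => by
        have := congrArg (fun γ : C(Icc (0 : ℝ) 1, E) => γ t) (hvar u)
        simp only [ContinuousMap.sub_apply, constCurveCLM_apply] at this
        exact sub_eq_iff_eq_add.1 this)
    refine ⟨w, hw0, (hwΓ ⟨1, h1⟩).trans (hΦd u).symm, fun t ht => ?_⟩
    have := hw ⟨t, ht⟩
    rwa [pointwiseApply_apply, ← hwΓ, nemytskii_apply, hΓ0] at this
  obtain ⟨w, hw0, hw1, hw⟩ := hcurve u
  obtain ⟨w', hw'0, hw'1, hw'⟩ := hcurve v
  have hder : ∀ t ∈ Icc (0 : ℝ) 1, HasDerivAt (fun s => B (w s) (w' s)) 0 t := fun t ht => by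
    have h6 := (B.hasFDerivAt.comp_hasDerivAt t (hw t ht)).clm_apply (hw' t ht)
    exact h6.congr_deriv (hB _ _ _)
  have := constant_of_has_deriv_right_zero
    (fun t ht => (hder t ht).continuousAt.continuousWithinAt)
    (fun t ht => (hder t (Ico_subset_Icc_self ht)).hasDerivWithinAt) 1 h1
  rw [← hw1, ← hw'1, this, hw0, hw'0]

end SmallFlow

section GlobalFlow

open Filter Topology

variable {E : Type} [NormedAddCommGroup E] [NormedSpace ℝ E]

/-- `Fl` is a complete flow of the vector field `Y`. -/
def IsGlobalFlow (Y : E → E) (Fl : ℝ → E → E) : Prop :=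
  (∀ z, Fl 0 z = z) ∧ ∀ z t, HasDerivAt (fun s => Fl s z) (Y (Fl t z)) t

lemma exists_curve_Ioo [CompleteSpace E] {Y : E → E} {K L : NNReal} (hK : LipschitzWith K Y)
    (hL : ∀ x, ‖Y x‖ ≤ L) (z : E) (T : NNReal) :
    ∃ c : ℝ → E, c 0 = z ∧ ∀ t ∈ Ioo (-(T : ℝ)) T, HasDerivAt c (Y (c t)) t := by
  have hpl : IsPicardLindelof (fun _ => Y) (tmin := -(T : ℝ)) (tmax := T)
      ⟨0, by simp⟩ z (L * T) 0 L K :=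
    IsPicardLindelof.of_time_independent (fun x _ => hL x) hK.lipschitzOnWith (by simp)
  obtain ⟨c, hc0, hc⟩ := hpl.exists_eq_forall_mem_Icc_hasDerivWithinAt₀
  exact ⟨c, hc0, fun t ht => (hc t (Ioo_subset_Icc_self ht)).hasDerivAt (Icc_mem_nhds ht.1 ht.2)⟩

theorem exists_isGlobalFlow [CompleteSpace E] {Y : E → E} {K L : NNReal}
    (hK : LipschitzWith K Y) (hL : ∀ x, ‖Y x‖ ≤ L) : ∃ Fl, IsGlobalFlow Y Fl := by
  choose c hc0 hc using fun z (T : ℕ) => exists_curve_Ioo hK hL z T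
  have key : ∀ z (M N : ℕ) t, t ∈ Ioo (-(M : ℝ)) M → t ∈ Ioo (-(N : ℝ)) N →
      c z M t = c z N t := by
    intro z M N t hM hN
    wlog h : M ≤ N generalizing M N
    · exact (this N M hN hM (le_of_not_ge h)).symm
    have h' : (M : ℝ) ≤ N := by exact_mod_cast h
    have hM' : (0 : ℝ) < M := by linarith [hM.1, hM.2]
    refine ODE_solution_unique_of_mem_Ioo (v := fun _ => Y) (s := fun _ => univ) (a := -(M : ℝ))
      (b := M) (t₀ := 0) (K := K) (fun _ _ => hK.lipschitzOnWith) (by simpa using hM')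
      (fun t ht => ⟨hc z M t ht, trivial⟩)
      (fun t ht => ⟨hc z N t ⟨?_, ?_⟩, trivial⟩) (by rw [hc0, hc0]) hM
    · simp only [NNReal.coe_natCast]; linarith [ht.1]
    · simp only [NNReal.coe_natCast]; linarith [ht.2]
  have hmem : ∀ (N : ℕ) (t : ℝ), |t| < N → t ∈ Ioo (-(N : ℝ)) N := fun N t h => abs_lt.1 h
  refine ⟨fun t z => c z (⌊|t|⌋₊ + 1) t, fun z => hc0 _ _, fun z t => ?_⟩
  have ht : |t| < (⌊|t|⌋₊ + 1 : ℕ) := by push_cast; exact Nat.lt_floor_add_one _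
  refine (hc z _ t (hmem _ _ ht)).congr_of_eventuallyEq ?_
  filter_upwards [isOpen_Ioo.mem_nhds (hmem _ _ ht)] with s hs
  exact key z _ _ s (hmem _ _ (by push_cast; exact Nat.lt_floor_add_one _)) hs

namespace IsGlobalFlow

variable {Y : E → E} {Fl : ℝ → E → E} {K : NNReal}

lemma eq_of_hasDerivAt (h : IsGlobalFlow Y Fl) (hK : LipschitzWith K Y) {c : ℝ → E}
    (hc : ∀ t, HasDerivAt c (Y (c t)) t) (t : ℝ) : c t = Fl t (c 0) :=
  congrFun (ODE_solution_unique_univ (v := fun _ => Y) (s := fun _ => univ) (t₀ := 0) (K := K)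
    (fun _ => hK.lipschitzOnWith) (fun t => ⟨hc t, trivial⟩) (fun t => ⟨h.2 (c 0) t, trivial⟩)
    (h.1 _).symm) t

lemma eq_of_hasDerivAt_Icc (h : IsGlobalFlow Y Fl) (hK : LipschitzWith K Y) {c : ℝ → E} {T : ℝ}
    (hc : ∀ t ∈ Icc 0 T, HasDerivAt c (Y (c t)) t) {t : ℝ} (ht : t ∈ Icc 0 T) :
    c t = Fl t (c 0) :=
  eqOn_Icc_of_hasDerivAt hK hc (fun t _ => h.2 (c 0) t) (h.1 _).symm ht

lemma add (h : IsGlobalFlow Y Fl) (hK : LipschitzWith K Y) (s t : ℝ) (z : E) :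
    Fl (s + t) z = Fl s (Fl t z) := by
  have := h.eq_of_hasDerivAt hK (c := fun s => Fl (s + t) z)
    (fun s => (h.2 z (s + t)).comp_add_const s t) s
  simpa using this

lemma neg_apply (h : IsGlobalFlow Y Fl) (hK : LipschitzWith K Y) (t : ℝ) (z : E) :
    Fl (-t) (Fl t z) = z := by
  rw [← h.add hK, neg_add_cancel, h.1]

lemma apply_neg (h : IsGlobalFlow Y Fl) (hK : LipschitzWith K Y) (t : ℝ) (z : E) :
    Fl t (Fl (-t) z) = z := by
  rw [← h.add hK, add_neg_cancel, h.1]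

lemma dist_le (h : IsGlobalFlow Y Fl) (hK : LipschitzWith K Y) {t : ℝ} (ht : t ∈ Icc (0 : ℝ) 1)
    (z w : E) : dist (Fl t z) (Fl t w) ≤ dist z w * Real.exp K := by
  refine (dist_le_of_trajectories_ODE (v := fun _ => Y) (K := K) (f := fun t => Fl t z)
    (g := fun t => Fl t w) (a := 0) (b := 1) (δ := dist z w) (fun _ => hK)
    (fun t _ => (h.2 z t).continuousAt.continuousWithinAt)
    (fun t _ => (h.2 z t).hasDerivWithinAt)
    (fun t _ => (h.2 w t).continuousAt.continuousWithinAt)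
    (fun t _ => (h.2 w t).hasDerivWithinAt) (by simp [h.1]) t ht).trans ?_
  gcongr
  nlinarith [ht.2, ht.1, K.2, show (0 : ℝ) ≤ K from K.2]

theorem contDiff_and_preserves [CompleteSpace E] (h : IsGlobalFlow Y Fl)
    (hY : ContDiff ℝ (⊤ : ℕ∞) Y) (hcs : HasCompactSupport Y) (t : ℝ) :
    ContDiff ℝ (⊤ : ℕ∞) (Fl t) ∧ ∀ B : E →L[ℝ] E →L[ℝ] ℝ,
      (∀ x a b, B (fderiv ℝ Y x a) b + B a (fderiv ℝ Y x b) = 0) →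
      ∀ z u v, B (fderiv ℝ (Fl t) z u) (fderiv ℝ (Fl t) z v) = B u v := by
  obtain ⟨K, hK⟩ := ContDiff.lipschitzWith_of_hasCompactSupport hcs hY (by simp)
  obtain ⟨N, hN⟩ := exists_nat_gt (|t| * K)
  have hN0 : (0 : ℝ) < N := lt_of_le_of_lt (by positivity) hN
  have hsmall : ∀ s : ℝ, |s| * K < 1 → ∀ z₀,
      ContDiffAt ℝ (⊤ : ℕ∞) (Fl s) z₀ ∧ ∀ B : E →L[ℝ] E →L[ℝ] ℝ,
      (∀ x a b, B (fderiv ℝ Y x a) b + B a (fderiv ℝ Y x b) = 0) →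
      ∀ u v, B (fderiv ℝ (Fl s) z₀ u) (fderiv ℝ (Fl s) z₀ v) = B u v := by
    intro s hs z₀
    have hsY : ContDiff ℝ (⊤ : ℕ∞) (fun x => s • Y x) := contDiff_const.smul hY
    obtain ⟨h1, h2⟩ := contDiffAt_timeOne_of_small (Y := ⟨fun x => s • Y x, hsY.continuous⟩)
      (K := ‖s‖₊ * K) hsY (hcs.smul_left (f := fun _ => s))
      (by
        refine LipschitzWith.of_dist_le_mul fun x y => ?_
        simp only [ContinuousMap.coe_mk, dist_smul₀, NNReal.coe_mul, coe_nnnorm, mul_assoc]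
        gcongr
        exact hK.dist_le_mul x y)
      (by rw [← NNReal.coe_lt_one]; simpa using hs)
      (Φ := Fl s) (fun z => ⟨fun r => Fl (s * r) z, by simp [h.1], fun r _ => by
        have := (h.2 z (s * r)).scomp r ((hasDerivAt_id r).const_mul s)
        simpa [Function.comp_def] using this, by simp⟩) z₀
    refine ⟨h1, fun B hB => h2 B fun x a b => ?_⟩
    have hd : fderiv ℝ (fun x => s • Y x) x = s • fderiv ℝ Y x :=
      fderiv_fun_const_smul (hY.differentiable (by simp) x) s
    change B (fderiv ℝ (fun x => s • Y x) x a) b + B a (fderiv ℝ (fun x => s • Y x) x b) = 0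
    have := hB x a b
    rw [hd]
    simp only [smul_apply, map_smul, smul_eq_mul]
    rw [← mul_add, this, mul_zero]
  have hs : |t / N| * K < 1 := by
    rw [abs_div, Nat.abs_cast, div_mul_eq_mul_div, div_lt_one hN0]
    exact hN
  have hind : ∀ n : ℕ, ContDiff ℝ (⊤ : ℕ∞) (Fl (n * (t / N))) ∧ ∀ B : E →L[ℝ] E →L[ℝ] ℝ,
      (∀ x a b, B (fderiv ℝ Y x a) b + B a (fderiv ℝ Y x b) = 0) →
      ∀ z u v, B (fderiv ℝ (Fl (n * (t / N))) z u) (fderiv ℝ (Fl (n * (t / N))) z v) = B u v := by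
    intro n
    induction n with
    | zero =>
      have h0 : Fl ((0 : ℕ) * (t / N)) = id := by
        ext z; simp [h.1]
      rw [h0]
      exact ⟨contDiff_id, fun B _ z u v => by simp⟩
    | succ n ih =>
      have h1 : Fl ((n + 1 : ℕ) * (t / N)) = Fl (t / N) ∘ Fl (n * (t / N)) := by
        ext z
        rw [Function.comp_apply, ← h.add hK]
        congr 1
        push_cast
        ring
      have h2 : ContDiff ℝ (⊤ : ℕ∞) (Fl (t / N)) :=
        contDiff_iff_contDiffAt.2 fun z => (hsmall _ hs z).1
      rw [h1]
      refine ⟨h2.comp ih.1, fun B hB z u v => ?_⟩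
      rw [fderiv_comp z (h2.differentiable (by simp) _) (ih.1.differentiable (by simp) _)]
      simp only [ContinuousLinearMap.comp_apply]
      rw [(hsmall _ hs _).2 B hB, ih.2 B hB]
  have := hind N
  rwa [mul_div_cancel₀ _ hN0.ne'] at this

end IsGlobalFlow

end GlobalFlow

section Hamiltonian

open Filter Topology

/-- The standard symplectic form as a continuous bilinear map. -/
def wcanCLM (m : ℕ) : EE m →L[ℝ] EE m →L[ℝ] ℝ :=
  LinearMap.toContinuousBilinearMap (LinearMap.mk₂ ℝ (wcan m)
    (fun a b c => by
      simp only [wcan, wB, Prod.fst_add, Prod.snd_add, Pi.add_apply, add_mul,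
        Finset.sum_add_distrib, Finset.sum_sub_distrib]
      ring)
    (fun r a b => by
      simp only [wcan, wB, Prod.smul_fst, Prod.smul_snd, Pi.smul_apply, smul_eq_mul, mul_assoc,
        ← mul_sub, ← Finset.mul_sum, ← mul_add])
    (fun a b c => by
      simp only [wcan, wB, Prod.fst_add, Prod.snd_add, Pi.add_apply, mul_add,
        Finset.sum_add_distrib, Finset.sum_sub_distrib]
      ring)
    (fun r a b => by
      simp only [wcan, wB, Prod.smul_fst, Prod.smul_snd, Pi.smul_apply, smul_eq_mul,
        mul_left_comm _ r, ← mul_sub, ← Finset.mul_sum, ← mul_add]))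

@[simp] lemma wcanCLM_apply (m : ℕ) (u v : EE m) : wcanCLM m u v = wcan m u v := rfl

lemma wcan_antisymm (m : ℕ) (u v : EE m) : wcan m u v = -wcan m v u := by
  simp only [wcan, wB, neg_add, ← Finset.sum_neg_distrib]
  congr 1
  · exact Finset.sum_congr rfl fun i _ => by ring
  · ring

lemma wcan_self (m : ℕ) (u : EE m) : wcan m u u = 0 := by
  linarith [wcan_antisymm m u u]

/-- The vector dual to a covector under the symplectic form. -/
def sharp (m : ℕ) : (EE m →L[ℝ] ℝ) →L[ℝ] EE m :=
  LinearMap.toContinuousLinearMap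
    { toFun := fun α => ((fun i => α ((0, Pi.single i 1), 0), fun i => -α ((Pi.single i 1, 0), 0)),
        (α (0, (0, 1)), -α (0, (1, 0))))
      map_add' := fun α β => by
        ext <;> simp [add_comm]
      map_smul' := fun r α => by
        ext <;> simp }

lemma sharp_apply (m : ℕ) (α : EE m →L[ℝ] ℝ) : sharp m α =
    ((fun i => α ((0, Pi.single i 1), 0), fun i => -α ((Pi.single i 1, 0), 0)),
        (α (0, (0, 1)), -α (0, (1, 0)))) := rfl

lemma wcan_sharp (m : ℕ) (α : EE m →L[ℝ] ℝ) (w : EE m) : wcan m (sharp m α) w = α w := by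
  have hw : w = (∑ i, w.1.2 i • (((0, Pi.single i 1), 0) : EE m)) +
      (∑ i, w.1.1 i • (((Pi.single i 1, 0), 0) : EE m)) +
      w.2.2 • ((0, (0, 1)) : EE m) + w.2.1 • ((0, (1, 0)) : EE m) := by
    ext j <;> simp [Prod.fst_sum, Prod.snd_sum, Finset.sum_apply, Pi.single_apply]
  conv_rhs => rw [hw]
  simp only [map_add, map_sum, map_smul, smul_eq_mul, wcan, wB, sharp_apply,
    ← Finset.sum_add_distrib]
  rw [add_assoc, ← sub_eq_zero]
  have : ∀ i, α ((0, Pi.single i 1), 0) * w.1.2 i - -α ((Pi.single i 1, 0), 0) * w.1.1 i =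
      w.1.2 i * α ((0, Pi.single i 1), 0) + w.1.1 i * α ((Pi.single i 1, 0), 0) := fun i => by ring
  simp only [this]
  ring

/-- The Hamiltonian vector field of `F`. -/
def hamVF {m : ℕ} (F : EE m → ℝ) (z : EE m) : EE m := sharp m (fderiv ℝ F z)

lemma wcan_hamVF {m : ℕ} (F : EE m → ℝ) (z w : EE m) :
    wcan m (hamVF F z) w = fderiv ℝ F z w := wcan_sharp m _ w

lemma fderiv_hamVF_self {m : ℕ} (F : EE m → ℝ) (z : EE m) : fderiv ℝ F z (hamVF F z) = 0 := by
  rw [← wcan_hamVF, wcan_self]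

lemma exists_compactSupport_extension {E : Type} [NormedAddCommGroup E] [NormedSpace ℝ E]
    [FiniteDimensional ℝ E] {M C : Set E} (hM : IsOpen M) (hC : IsCompact C) (hCM : C ⊆ M)
    {F : E → ℝ} (hF : ContDiffOn ℝ (⊤ : ℕ∞) F M) :
    ∃ G : E → ℝ, ContDiff ℝ (⊤ : ℕ∞) G ∧ HasCompactSupport G ∧
      ∃ U, IsOpen U ∧ C ⊆ U ∧ U ⊆ M ∧ EqOn G F U := by
  obtain ⟨L, hL, hCL, hLM⟩ := exists_compact_between hC hM hCM
  obtain ⟨χ, hχ1, hχ0, -⟩ := exists_contMDiffMap_one_nhds_of_subset_interior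
    (modelWithCornersSelf ℝ E) (n := (⊤ : ℕ∞)) hC.isClosed hCL
  have hχ : ContDiff ℝ (⊤ : ℕ∞) χ := χ.contMDiff.contDiff
  obtain ⟨U, hU, hCU, hUχ⟩ := eventually_nhdsSet_iff_exists.1 hχ1
  refine ⟨fun z => χ z * F z, contDiff_iff_contDiffAt.2 fun z => ?_,
    HasCompactSupport.intro hL fun z hz => by simp [hχ0 z hz], U ∩ M, hU.inter hM,
    subset_inter hCU hCM, inter_subset_right, fun z hz => by simp [hUχ z hz.1]⟩
  by_cases hz : z ∈ M
  · exact hχ.contDiffAt.mul (hF.contDiffAt (hM.mem_nhds hz))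
  · have hzL : Lᶜ ∈ 𝓝 z := hL.isClosed.isOpen_compl.mem_nhds fun h => hz (hLM h)
    refine (contDiffAt_const (c := (0 : ℝ))).congr_of_eventuallyEq ?_
    filter_upwards [hzL] with w hw
    simp [hχ0 w hw]

/-- Near a compact set, a Hamiltonian vector field agrees with a complete one, whose flow is
smooth, symplectic, and preserves an extension of the Hamiltonian. -/
theorem exists_local_flow {m : ℕ} {M C : Set (EE m)} (hM : IsOpen M) (hC : IsCompact C)
    (hCM : C ⊆ M) {F : EE m → ℝ} (hF : ContDiffOn ℝ (⊤ : ℕ∞) F M) :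
    ∃ (Y : EE m → EE m) (Fl : ℝ → EE m → EE m) (K : NNReal) (U : Set (EE m)) (G : EE m → ℝ),
      IsOpen U ∧ C ⊆ U ∧ U ⊆ M ∧ EqOn Y (hamVF F) U ∧ EqOn G F U ∧
      LipschitzWith K Y ∧ IsGlobalFlow Y Fl ∧ (∀ t z, G (Fl t z) = G z) ∧
      ∀ t, ContDiff ℝ (⊤ : ℕ∞) (Fl t) ∧ ∀ z u v,
        wcan m (fderiv ℝ (Fl t) z u) (fderiv ℝ (Fl t) z v) = wcan m u v := by
  obtain ⟨G, hG, hGc, U, hU, hCU, hUM, hGF⟩ := exists_compactSupport_extension hM hC hCM hF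
  have hdG : ContDiff ℝ (⊤ : ℕ∞) (fderiv ℝ G) := hG.fderiv_right (by simp)
  have hs : ContDiff ℝ (⊤ : ℕ∞) (sharp m) := by fun_prop
  have hY : ContDiff ℝ (⊤ : ℕ∞) (hamVF G) := hs.comp hdG
  have hYc : HasCompactSupport (hamVF G) := (hGc.fderiv ℝ).comp_left (map_zero (sharp m))
  obtain ⟨K, hK⟩ := ContDiff.lipschitzWith_of_hasCompactSupport hYc hY (by simp)
  obtain ⟨L, hL⟩ := hYc.exists_bound_of_continuous hY.continuous
  obtain ⟨Fl, hFl⟩ := exists_isGlobalFlow hK (L := L.toNNReal)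
    fun x => (hL x).trans (Real.le_coe_toNNReal L)
  refine ⟨hamVF G, Fl, K, U, G, hU, hCU, hUM, fun z hz => ?_, hGF, hK, hFl, fun t z => ?_,
    fun t => ?_⟩
  · have : G =ᶠ[𝓝 z] F := by
      filter_upwards [hU.mem_nhds hz] with w hw using hGF hw
    rw [hamVF, this.fderiv_eq, hamVF]
  · have hd : ∀ t, HasDerivAt (fun s => G (Fl s z)) 0 t := fun t => by
      have := (hG.differentiable (by simp) (Fl t z)).hasFDerivAt.comp_hasDerivAt t (hFl.2 z t)
      rwa [fderiv_hamVF_self] at this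
    have := is_const_of_deriv_eq_zero (fun t => (hd t).differentiableAt) (fun t => (hd t).deriv) t 0
    simpa [hFl.1] using this
  · obtain ⟨h1, h2⟩ := hFl.contDiff_and_preserves hY hYc t
    refine ⟨h1, fun z u v => h2 (wcanCLM m) (fun x a b => ?_) z u v⟩
    have hd : ∀ a, fderiv ℝ (hamVF G) x a = sharp m (fderiv ℝ (fderiv ℝ G) x a) := fun a => by
      have : HasFDerivAt (hamVF G) ((sharp m).comp (fderiv ℝ (fderiv ℝ G) x)) x :=
        (sharp m).hasFDerivAt.comp x (hdG.differentiable (by simp) x).hasFDerivAt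
      rw [this.fderiv]; rfl
    have hsym : IsSymmSndFDerivAt ℝ G x := hG.contDiffAt.isSymmSndFDerivAt (by
      rw [minSmoothness_of_isRCLikeNormedField]
      exact WithTop.coe_le_coe.2 (le_top : (2 : ℕ∞) ≤ ⊤))
    rw [hd, hd, wcanCLM_apply, wcanCLM_apply, wcan_sharp, wcan_antisymm, wcan_sharp, hsym a b]
    ring

/-- The time-one map of `X` on `M` sends `z` to `w`. -/
def FlowsTo {m : ℕ} (M : Set (EE m)) (X : EE m → EE m) (z w : EE m) : Prop :=
  ∃ γ : ℝ → EE m, γ 0 = z ∧ (∀ t ∈ Icc (0 : ℝ) 1, γ t ∈ M ∧ HasDerivAt γ (X (γ t)) t) ∧ γ 1 = w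

section FlowsTo

variable {m : ℕ} {M : Set (EE m)} {F : EE m → ℝ} {z w z' w' : EE m}

lemma isCompact_trajectory {γ : ℝ → EE m} {X : EE m → EE m}
    (h : ∀ t ∈ Icc (0 : ℝ) 1, γ t ∈ M ∧ HasDerivAt γ (X (γ t)) t) :
    IsCompact (γ '' Icc 0 1) ∧ γ '' Icc 0 1 ⊆ M :=
  ⟨isCompact_Icc.image_of_continuousOn fun t ht => (h t ht).2.continuousAt.continuousWithinAt,
    image_subset_iff.2 fun t ht => (h t ht).1⟩

lemma FlowsTo.unique_aux (hM : IsOpen M) (hF : ContDiffOn ℝ (⊤ : ℕ∞) F M)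
    (h : FlowsTo M (hamVF F) z w) (h' : FlowsTo M (hamVF F) z' w') : z = z' ↔ w = w' := by
  obtain ⟨γ, rfl, hγ, rfl⟩ := h
  obtain ⟨γ', rfl, hγ', rfl⟩ := h'
  obtain ⟨h1, h2⟩ := isCompact_trajectory hγ
  obtain ⟨h1', h2'⟩ := isCompact_trajectory hγ'
  obtain ⟨Y, Fl, K, U, G, hU, hCU, hUM, hYF, hGF, hK, hFl, -, -⟩ :=
    exists_local_flow hM (h1.union h1') (union_subset h2 h2') hF
  have hm : (1 : ℝ) ∈ Icc (0 : ℝ) 1 := by simp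
  have e1 := hFl.eq_of_hasDerivAt_Icc hK (c := γ) (T := 1) (fun t ht => by
    rw [hYF (hCU (Or.inl (mem_image_of_mem _ ht)))]
    exact (hγ t ht).2) hm
  have e2 := hFl.eq_of_hasDerivAt_Icc hK (c := γ') (T := 1) (fun t ht => by
    rw [hYF (hCU (Or.inr (mem_image_of_mem _ ht)))]
    exact (hγ' t ht).2) hm
  rw [e1, e2]
  refine ⟨fun h => by rw [h], fun h => ?_⟩
  rw [← hFl.neg_apply hK 1 (γ 0), h, hFl.neg_apply hK]

theorem FlowsTo.exists_local_diffeo (hM : IsOpen M) (hF : ContDiffOn ℝ (⊤ : ℕ∞) F M)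
    (h : FlowsTo M (hamVF F) z w) :
    ∃ Φ Ψ : EE m → EE m, ContDiff ℝ (⊤ : ℕ∞) Φ ∧ ContDiff ℝ (⊤ : ℕ∞) Ψ ∧
      (∀ x u v, wcan m (fderiv ℝ Φ x u) (fderiv ℝ Φ x v) = wcan m u v) ∧
      (∀ᶠ x in 𝓝 z, FlowsTo M (hamVF F) x (Φ x)) ∧
      ∀ᶠ x in 𝓝 w, FlowsTo M (hamVF F) (Ψ x) x := by
  obtain ⟨γ, rfl, hγ, rfl⟩ := h
  obtain ⟨h1, h2⟩ := isCompact_trajectory hγ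
  obtain ⟨Y, Fl, K, U, G, hU, hCU, hUM, hYF, hGF, hK, hFl, -, hFls⟩ :=
    exists_local_flow hM h1 h2 hF
  obtain ⟨δ, hδ, hδU⟩ := h1.exists_thickening_subset_open hU hCU
  have e : ∀ t ∈ Icc (0 : ℝ) 1, γ t = Fl t (γ 0) := fun t ht =>
    hFl.eq_of_hasDerivAt_Icc hK (c := γ) (T := 1) (fun t ht => by
      rw [hYF (hCU (mem_image_of_mem _ ht))]
      exact (hγ t ht).2) ht
  have hflow : ∀ x, dist x (γ 0) * Real.exp K < δ → FlowsTo M (hamVF F) x (Fl 1 x) := by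
    intro x hx
    have hmem : ∀ t ∈ Icc (0 : ℝ) 1, Fl t x ∈ U := fun t ht => by
      refine hδU (Metric.mem_thickening_iff.2 ⟨γ t, mem_image_of_mem _ ht, ?_⟩)
      rw [e t ht]
      exact (hFl.dist_le hK ht _ _).trans_lt hx
    refine ⟨fun t => Fl t x, hFl.1 x, fun t ht => ⟨hUM (hmem t ht), ?_⟩, rfl⟩
    rw [← hYF (hmem t ht)]
    exact hFl.2 x t
  have hnear : ∀ᶠ x in 𝓝 (γ 0), dist x (γ 0) * Real.exp K < δ := by
    refine ContinuousAt.eventually_lt (by fun_prop) continuousAt_const (by simpa using hδ)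
  refine ⟨Fl 1, Fl (-1), (hFls 1).1, (hFls (-1)).1, (hFls 1).2, hnear.mono hflow, ?_⟩
  have hc : Tendsto (Fl (-1)) (𝓝 (γ 1)) (𝓝 (γ 0)) := by
    have := (hFls (-1)).1.continuous.tendsto (γ 1)
    rw [e 1 (by simp)] at this ⊢
    rwa [hFl.neg_apply hK] at this
  filter_upwards [hc.eventually hnear] with x hx
  have := hflow _ hx
  rwa [hFl.apply_neg hK] at this

/-- Trajectories on a compact level set are complete. -/
theorem exists_complete_trajectory (hM : IsOpen M) (hF : ContDiffOn ℝ (⊤ : ℕ∞) F M)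
    (hC : IsCompact {x ∈ M | F x = F z}) (hz : z ∈ M) :
    ∃ γ : ℝ → EE m, γ 0 = z ∧ ∀ t, γ t ∈ M ∧ F (γ t) = F z ∧ HasDerivAt γ (hamVF F (γ t)) t := by
  obtain ⟨Y, Fl, K, U, G, hU, hCU, hUM, hYF, hGF, hK, hFl, hGc, -⟩ :=
    exists_local_flow hM hC (fun _ h => h.1) hF
  have hcont : Continuous fun t => Fl t z :=
    continuous_iff_continuousAt.2 fun t => (hFl.2 z t).continuousAt
  have hzC : z ∈ {x ∈ M | F x = F z} := ⟨hz, rfl⟩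
  have hclopen : IsClopen ((fun t => Fl t z) ⁻¹' {x ∈ M | F x = F z}) := by
    refine ⟨hC.isClosed.preimage hcont, isOpen_iff_mem_nhds.2 fun t ht => ?_⟩
    filter_upwards [hcont.continuousAt.eventually (hU.mem_nhds (hCU ht))] with s hs
    refine ⟨hUM hs, ?_⟩
    rw [← hGF hs, hGc, hGF (hCU hzC)]
  have huniv := hclopen.eq_univ ⟨0, by simpa [hFl.1] using hz⟩
  have hmem : ∀ t, Fl t z ∈ {x ∈ M | F x = F z} := fun t => by
    have : t ∈ (fun t => Fl t z) ⁻¹' {x ∈ M | F x = F z} := by rw [huniv]; trivial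
    exact this
  refine ⟨fun t => Fl t z, hFl.1 z, fun t => ⟨(hmem t).1, (hmem t).2, ?_⟩⟩
  rw [← hYF (hCU (hmem t))]
  exact hFl.2 z t

lemma FlowsTo.of_hasDerivAt {X : EE m → EE m} {γ : ℝ → EE m}
    (h : ∀ t, γ t ∈ M ∧ HasDerivAt γ (X (γ t)) t) (s : ℝ) : FlowsTo M X (γ s) (γ (1 + s)) :=
  ⟨fun t => γ (t + s), by simp, fun t _ => ⟨(h _).1, (h (t + s)).2.comp_add_const t s⟩, rfl⟩

theorem exists_timeOne_symplectomorphism {N : Set (EE m)} (hM : IsOpen M) (hN : IsOpen N)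
    (hF : ContDiffOn ℝ (⊤ : ℕ∞) F M)
    (hfwd : ∀ z ∈ N, ∃ w, FlowsTo M (hamVF F) z w)
    (hbwd : ∀ w ∈ M, ∃ z ∈ N, FlowsTo M (hamVF F) z w) :
    ∃ φ : EE m → EE m, (∀ z ∈ N, FlowsTo M (hamVF F) z (φ z)) ∧
      ContDiffOn ℝ (⊤ : ℕ∞) φ N ∧ BijOn φ N M ∧
      (∃ ψ : EE m → EE m, ContDiffOn ℝ (⊤ : ℕ∞) ψ M ∧ InvOn ψ φ N M) ∧
      (∀ z ∈ N, ∀ u v, wcan m (fderiv ℝ φ z u) (fderiv ℝ φ z v) = wcan m u v) := by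
  classical
  choose! φ hφ using hfwd
  choose! ψ hψN hψ using hbwd
  have hφM : MapsTo φ N M := fun z hz => by
    obtain ⟨γ, -, hγ, h1⟩ := hφ z hz
    rw [← h1]
    exact (hγ 1 (by simp)).1
  have hinv : InvOn ψ φ N M :=
    ⟨fun z hz => (FlowsTo.unique_aux hM hF (hψ _ (hφM hz)) (hφ z hz)).2 rfl,
      fun w hw => (FlowsTo.unique_aux hM hF (hφ _ (hψN w hw)) (hψ w hw)).1 rfl⟩
  have hloc : ∀ z ∈ N, ∃ Φ : EE m → EE m, ContDiff ℝ (⊤ : ℕ∞) Φ ∧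
      (∀ x u v, wcan m (fderiv ℝ Φ x u) (fderiv ℝ Φ x v) = wcan m u v) ∧ φ =ᶠ[𝓝 z] Φ := by
    intro z hz
    obtain ⟨Φ, -, hΦ, -, hΦs, hΦz, -⟩ := (hφ z hz).exists_local_diffeo hM hF
    refine ⟨Φ, hΦ, hΦs, ?_⟩
    filter_upwards [hΦz, hN.mem_nhds hz] with x hx hxN
    exact (FlowsTo.unique_aux hM hF (hφ x hxN) hx).1 rfl
  refine ⟨φ, hφ, fun z hz => ?_, hinv.bijOn hφM hψN, ⟨ψ, fun w hw => ?_, hinv⟩,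
    fun z hz u v => ?_⟩
  · obtain ⟨Φ, hΦ, -, he⟩ := hloc z hz
    exact (hΦ.contDiffAt.congr_of_eventuallyEq he).contDiffWithinAt
  · obtain ⟨-, Ψ, -, hΨ, -, -, hΨw⟩ := (hψ w hw).exists_local_diffeo hM hF
    refine (hΨ.contDiffAt.congr_of_eventuallyEq ?_).contDiffWithinAt
    filter_upwards [hΨw, hM.mem_nhds hw] with x hx hxM
    exact (FlowsTo.unique_aux hM hF (hψ x hxM) hx).2 rfl
  · obtain ⟨Φ, hΦ, hs, he⟩ := hloc z hz
    rw [he.fderiv_eq, hs]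

end FlowsTo

end Hamiltonian

section LowerSemicontinuousApproximation

open Filter Topology

lemma exists_upperSemicontinuous_approx {B : Type} [PseudoMetricSpace B] {l : B → ℝ} (hl : LowerSemicontinuous l)
    (h0 : ∀ p, 0 < l p) : ∃ c : ℕ → B → ℝ, (∀ k, UpperSemicontinuous (c k)) ∧
      (∀ k p, c k p < l p) ∧ ∀ p x, x < l p → ∀ᶠ k in atTop, x < c k p := by
  have hbdd : ∀ (k : ℕ) p, BddBelow (range fun q => l q + k * dist p q) := fun k p =>
    ⟨0, by rintro _ ⟨q, rfl⟩; have := h0 q; positivity⟩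
  refine ⟨fun k p => (⨅ q, (l q + k * dist p q)) - 1 / ((k : ℝ) + 1), fun k => ?_, fun k p => ?_,
    fun p x hx => ?_⟩
  · simp only [sub_eq_add_neg]
    refine UpperSemicontinuous.add (upperSemicontinuous_ciInf (hbdd k) fun q => ?_)
      continuous_const.upperSemicontinuous
    exact Continuous.upperSemicontinuous (by fun_prop)
  · have h1 := ciInf_le (hbdd k p) p
    simp only [dist_self, mul_zero, add_zero] at h1
    have : (0 : ℝ) < 1 / ((k : ℝ) + 1) := by positivity
    linarith
  · obtain ⟨y, hxy, hy⟩ := exists_between hx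
    obtain ⟨δ, hδ, hball⟩ := Metric.eventually_nhds_iff.1 (hl p y hy)
    have e1 : ∀ᶠ k : ℕ in atTop, y ≤ k * δ :=
      (tendsto_natCast_atTop_atTop.atTop_mul_const hδ).eventually_ge_atTop y
    have e2 : ∀ᶠ k : ℕ in atTop, 1 / ((k : ℝ) + 1) < y - x :=
      tendsto_one_div_add_atTop_nhds_zero_nat.eventually_lt_const (sub_pos.2 hxy)
    filter_upwards [e1, e2] with k h1 h2
    have : y ≤ ⨅ q, (l q + k * dist p q) := by
      have : Nonempty B := ⟨p⟩
      refine le_ciInf fun q => ?_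
      rcases lt_or_ge (dist q p) δ with h | h
      · have := hball h
        have : (0 : ℝ) ≤ k * dist p q := by positivity
        linarith
      · rw [dist_comm] at h
        have : (k : ℝ) * δ ≤ k * dist p q := by gcongr
        linarith [h0 q]
    linarith

variable {B : Type} [NormedAddCommGroup B] [NormedSpace ℝ B] [FiniteDimensional ℝ B]

lemma exists_contDiff_between {u v : B → ℝ} (hu : UpperSemicontinuous u)
    (hv : LowerSemicontinuous v) (huv : ∀ p, u p < v p) :
    ∃ g : B → ℝ, ContDiff ℝ (⊤ : ℕ∞) g ∧ ∀ p, g p ∈ Ioo (u p) (v p) := by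
  obtain ⟨g, hg⟩ := exists_contMDiffMap_forall_mem_convex_of_local_const
    (modelWithCornersSelf ℝ B) (n := (⊤ : ℕ∞)) (t := fun p => Ioo (u p) (v p))
    (fun p => convex_Ioo _ _) (fun p => by
      obtain ⟨c, h1, h2⟩ := exists_between (huv p)
      exact ⟨c, (hu p c h1).and (hv p c h2)⟩)
  exact ⟨g, g.contMDiff.contDiff, hg⟩

/-- A sequence of levels increasing to `1`. -/
def level (k : ℕ) : ℝ := 1 - 1 / ((k : ℝ) + 2)

lemma level_strictMono : StrictMono level := strictMono_nat_of_lt_succ fun k => by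
  unfold level
  push_cast
  gcongr
  linarith

lemma level_lt_one (k : ℕ) : level k < 1 := by
  have : (0 : ℝ) < 1 / ((k : ℝ) + 2) := by positivity
  unfold level; linarith

lemma level_pos (k : ℕ) : 0 < level k := by
  have : level 0 ≤ level k := level_strictMono.monotone (Nat.zero_le k)
  norm_num [level] at this ⊢
  linarith

lemma eventually_lt_level {x : ℝ} (hx : x < 1) : ∀ᶠ k in atTop, x < level k := by
  obtain ⟨N, hN⟩ := exists_nat_gt (1 / (1 - x))
  filter_upwards [eventually_ge_atTop N] with k hk
  have h1 : 0 < 1 - x := by linarith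
  have hk' : (N : ℝ) ≤ k := by exact_mod_cast hk
  have : 1 / ((k : ℝ) + 2) < 1 - x := by
    rw [div_lt_comm₀ (by positivity) h1]
    linarith
  unfold level; linarith

/-- A sequence of smooth functions increasing to `l`, adapted to the sequence `level`. -/
structure IsLevelApprox (l : B → ℝ) (g : ℕ → B → ℝ) : Prop where
  contDiff : ∀ k, ContDiff ℝ (⊤ : ℕ∞) (g k)
  pos : ∀ k p, 0 < g k p
  lt : ∀ k p, g k p < l p
  lt_level : ∀ k p, g k p < level k
  lt_succ : ∀ k p, g k p < g (k + 1) p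
  succ_lt_level : ∀ k p, g (k + 1) p < level k
  exists_lt : ∀ p x, x < l p → ∃ k, x < g k p

theorem exists_contDiff_approx {l : B → ℝ} (hl : LowerSemicontinuous l)
    (h0 : ∀ p, 0 < l p) (h1 : ∀ p, l p ≤ 1) : ∃ g : ℕ → B → ℝ, IsLevelApprox l g := by
  obtain ⟨c, hc, hcl, hcx⟩ := exists_upperSemicontinuous_approx hl h0
  let P : ℕ → (B → ℝ) → Prop := fun k g => ContDiff ℝ (⊤ : ℕ∞) g ∧ (∀ p, 0 < g p) ∧
    (∀ p, g p < l p) ∧ ∀ p, g p < level k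
  have hv : ∀ k, LowerSemicontinuous fun p => min (l p) (level k) := fun k =>
    hl.inf continuous_const.lowerSemicontinuous
  obtain ⟨g0, hg0, hg0'⟩ := exists_contDiff_between (u := fun _ => (0 : ℝ))
    continuous_const.upperSemicontinuous (hv 0) fun p => lt_min (h0 p) (level_pos 0)
  have hP0 : P 0 g0 := ⟨hg0, fun p => (hg0' p).1, fun p => (lt_min_iff.1 (hg0' p).2).1,
    fun p => (lt_min_iff.1 (hg0' p).2).2⟩
  have step : ∀ k g, P k g → ∃ g', P (k + 1) g' ∧ (∀ p, g p < g' p) ∧ (∀ p, g' p < level k) ∧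
      ∀ p, min (c k p) (level k - 1 / ((k : ℝ) + 1)) < g' p := by
    intro k g hg
    obtain ⟨g', hg', hb⟩ := exists_contDiff_between
      (u := fun p => max (g p) (min (c k p) (level k - 1 / ((k : ℝ) + 1))))
      (hg.1.continuous.upperSemicontinuous.sup ((hc k).inf
        continuous_const.upperSemicontinuous)) (hv k) fun p => by
      have : (0 : ℝ) < 1 / ((k : ℝ) + 1) := by positivity
      refine max_lt (lt_min (hg.2.2.1 p) (hg.2.2.2 p)) (lt_min ?_ ?_)
      · exact (min_le_left _ _).trans_lt (hcl k p)
      · exact (min_le_right _ _).trans_lt (by linarith)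
    have hlo := fun p => max_lt_iff.1 (hb p).1
    have hhi := fun p => lt_min_iff.1 (hb p).2
    exact ⟨g', ⟨hg', fun p => (hg.2.1 p).trans (hlo p).1, fun p => (hhi p).1,
      fun p => (hhi p).2.trans (level_strictMono k.lt_succ_self)⟩, fun p => (hlo p).1,
      fun p => (hhi p).2, fun p => (hlo p).2⟩
  choose! next hnext using step
  let g : ℕ → B → ℝ := fun k => Nat.rec g0 next k
  have hP : ∀ k, P k (g k) := fun k => by
    induction k with
    | zero => exact hP0
    | succ k ih => exact (hnext k _ ih).1
  refine ⟨g, fun k => (hP k).1, fun k => (hP k).2.1, fun k => (hP k).2.2.1, fun k => (hP k).2.2.2,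
    fun k => (hnext k _ (hP k)).2.1, fun k => (hnext k _ (hP k)).2.2.1, fun p x hx => ?_⟩
  have hx1 : x < 1 := hx.trans_le (h1 p)
  obtain ⟨y, hxy, hy⟩ := exists_between hx1
  have e2 : ∀ᶠ k : ℕ in atTop, 1 / ((k : ℝ) + 1) < y - x :=
    tendsto_one_div_add_atTop_nhds_zero_nat.eventually_lt_const (sub_pos.2 hxy)
  obtain ⟨k, ⟨hk1, hk2⟩, hk3⟩ := (((hcx p x hx).and (eventually_lt_level hy)).and e2).exists
  exact ⟨k + 1, (lt_min hk1 (by linarith)).trans ((hnext k _ (hP k)).2.2.2 p)⟩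

end LowerSemicontinuousApproximation

section Potential

open Filter Topology

variable {B : Type} [NormedAddCommGroup B] [NormedSpace ℝ B]

/-- The coefficient of the logarithmic part of the potential. -/
def logCoef (g : ℕ → B → ℝ) (p : B) : ℝ := -(Real.log (g 0 p))⁻¹

/-- A smooth monotone function that is `0` below `level k` and `1` above `level (k + 1)`. -/
def levelStep (k : ℕ) (x : ℝ) : ℝ :=
  Real.smoothTransition ((x - level k) / (level (k + 1) - level k))

/-- The successive non-logarithmic parts of the potential. -/
def rise (g : ℕ → B → ℝ) : ℕ → B × ℝ → ℝ
  | 0 => fun _ => 0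
  | k + 1 => fun z => rise g k z + (rise g k (z.1, g (k + 1) z.1) - rise g k (z.1, g k z.1) +
      logCoef g z.1 * (Real.log (g (k + 1) z.1) - Real.log (g k z.1))) * levelStep k z.2

/-- The limit of `rise g k` as `k` tends to infinity. -/
def riseLim (g : ℕ → B → ℝ) (z : B × ℝ) : ℝ := rise g ⌈1 / (1 - z.2)⌉₊ z

/-- The potential built from the sequence `g`. -/
def potential (g : ℕ → B → ℝ) (z : B × ℝ) : ℝ := logCoef g z.1 * Real.log z.2 + riseLim g z

lemma levelStep_eq_zero {k : ℕ} {x : ℝ} (hx : x ≤ level k) : levelStep k x = 0 :=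
  Real.smoothTransition.zero_of_nonpos (div_nonpos_of_nonpos_of_nonneg (by linarith)
    (by linarith [level_strictMono k.lt_succ_self]))

lemma levelStep_eq_one {k : ℕ} {x : ℝ} (hx : level (k + 1) ≤ x) : levelStep k x = 1 :=
  Real.smoothTransition.one_of_one_le
    ((one_le_div (by linarith [level_strictMono k.lt_succ_self])).2 (by linarith))

lemma levelStep_nonneg (k : ℕ) (x : ℝ) : 0 ≤ levelStep k x := Real.smoothTransition.nonneg _

lemma levelStep_monotone (k : ℕ) : Monotone (levelStep k) := fun x y h => by
  have := level_strictMono k.lt_succ_self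
  refine Real.smoothTransition.monotone (div_le_div_of_nonneg_right (by linarith) (by linarith))

lemma contDiff_levelStep (k : ℕ) : ContDiff ℝ (⊤ : ℕ∞) (levelStep k) :=
  Real.smoothTransition.contDiff.comp (by fun_prop)

lemma le_level_ceil {x : ℝ} (hx : x < 1) : x ≤ level ⌈1 / (1 - x)⌉₊ := by
  have h1 : 0 < 1 - x := by linarith
  have : 1 / ((⌈1 / (1 - x)⌉₊ : ℝ) + 2) ≤ 1 - x := by
    rw [div_le_comm₀ (by positivity) h1]
    linarith [Nat.le_ceil (1 / (1 - x))]
  unfold level; linarith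

lemma rise_eq_of_le {B : Type} {g : ℕ → B → ℝ} {p : B} {x : ℝ} {k j : ℕ} (hx : x ≤ level k) (hkj : k ≤ j) :
    rise g j (p, x) = rise g k (p, x) := by
  induction j, hkj using Nat.le_induction with
  | base => rfl
  | succ j hkj ih =>
    simp only [rise]
    rw [ih, levelStep_eq_zero (hx.trans (level_strictMono.monotone hkj)), mul_zero, add_zero]

lemma riseLim_eq {B : Type} {g : ℕ → B → ℝ} {p : B} {x : ℝ} {k : ℕ} (hx : x ≤ level k) :
    riseLim g (p, x) = rise g k (p, x) := by
  have hx1 := le_level_ceil (hx.trans_lt (level_lt_one k))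
  rw [riseLim, ← rise_eq_of_le hx1 (le_max_left _ k), rise_eq_of_le hx (le_max_right _ _)]

namespace IsLevelApprox

variable {l : B → ℝ} {g : ℕ → B → ℝ}

lemma lt_one (h : IsLevelApprox l g) (k : ℕ) (p : B) : g k p < 1 :=
  (h.lt_level k p).trans (level_lt_one k)

lemma log_neg (h : IsLevelApprox l g) (p : B) : Real.log (g 0 p) < 0 :=
  Real.log_neg (h.pos 0 p) (h.lt_one 0 p)

lemma logCoef_pos (h : IsLevelApprox l g) (p : B) : 0 < logCoef g p :=
  neg_pos.2 (inv_lt_zero.2 (h.log_neg p))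

lemma logCoef_mul_log (h : IsLevelApprox l g) (p : B) : logCoef g p * Real.log (g 0 p) = -1 := by
  rw [logCoef, neg_mul, inv_mul_cancel₀ (h.log_neg p).ne]

lemma contDiff_logCoef (h : IsLevelApprox l g) : ContDiff ℝ (⊤ : ℕ∞) (logCoef g) :=
  (((h.contDiff 0).log fun p => (h.pos 0 p).ne').inv fun p => (h.log_neg p).ne).neg

lemma contDiff_rise (h : IsLevelApprox l g) (k : ℕ) : ContDiff ℝ (⊤ : ℕ∞) (rise g k) := by
  induction k with
  | zero => exact contDiff_const
  | succ k ih =>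
    have h1 : ∀ j, ContDiff ℝ (⊤ : ℕ∞) fun z : B × ℝ => g j z.1 := fun j =>
      (h.contDiff j).comp contDiff_fst
    have h2 : ∀ j, ContDiff ℝ (⊤ : ℕ∞) fun z : B × ℝ => Real.log (g j z.1) := fun j =>
      (h1 j).log fun z => (h.pos j z.1).ne'
    have h3 : ∀ j, ContDiff ℝ (⊤ : ℕ∞) fun z : B × ℝ => rise g k (z.1, g j z.1) := fun j =>
      ih.comp (contDiff_fst.prodMk (h1 j))
    exact ih.add ((((h3 (k + 1)).sub (h3 k)).add ((h.contDiff_logCoef.comp contDiff_fst).mul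
      ((h2 (k + 1)).sub (h2 k)))).mul ((contDiff_levelStep k).comp contDiff_snd))

lemma rise_monotone (h : IsLevelApprox l g) (k : ℕ) (p : B) :
    Monotone fun x => rise g k (p, x) := by
  induction k with
  | zero => exact monotone_const
  | succ k ih =>
    change Monotone fun x => rise g k (p, x) + (rise g k (p, g (k + 1) p) - rise g k (p, g k p) +
      logCoef g p * (Real.log (g (k + 1) p) - Real.log (g k p))) * levelStep k x
    refine ih.add ((levelStep_monotone k).const_mul ?_)
    have h1 : rise g k (p, g k p) ≤ rise g k (p, g (k + 1) p) := ih (h.lt_succ k p).le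
    have h2 := Real.log_le_log (h.pos k p) (h.lt_succ k p).le
    have h3 := mul_nonneg (h.logCoef_pos p).le (sub_nonneg.2 h2)
    linarith

lemma rise_le_succ (h : IsLevelApprox l g) (k : ℕ) (z : B × ℝ) :
    rise g k z ≤ rise g (k + 1) z := by
  have h1 : rise g k (z.1, g k z.1) ≤ rise g k (z.1, g (k + 1) z.1) :=
    h.rise_monotone k z.1 (h.lt_succ k z.1).le
  have h2 := Real.log_le_log (h.pos k z.1) (h.lt_succ k z.1).le
  have h3 := mul_nonneg (h.logCoef_pos z.1).le (sub_nonneg.2 h2)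
  have h4 := mul_nonneg (add_nonneg (sub_nonneg.2 h1) h3) (levelStep_nonneg k z.2)
  simp only [rise]
  linarith

end IsLevelApprox

variable {l : B → ℝ} {g : ℕ → B → ℝ}

namespace IsLevelApprox

lemma rise_le_riseLim (h : IsLevelApprox l g) (k : ℕ) (p : B) {x : ℝ} (hx : x < 1) :
    rise g k (p, x) ≤ riseLim g (p, x) := by
  rw [riseLim_eq ((le_level_ceil hx).trans
    (level_strictMono.monotone (le_max_left _ k)))]
  exact monotone_nat_of_le_succ (fun j => h.rise_le_succ j (p, x)) (le_max_right _ _)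

lemma rise_eq_of_ge (h : IsLevelApprox l g) (k : ℕ) (p : B) {x : ℝ} (hx : level k ≤ x) :
    rise g k (p, x) = rise g k (p, g k p) + logCoef g p * Real.log (g k p) + 1 := by
  induction k with
  | zero =>
    rw [h.logCoef_mul_log]
    simp [rise]
  | succ k ih =>
    have h1 := ih ((level_strictMono k.lt_succ_self).le.trans hx)
    rw [rise_eq_of_le (h.succ_lt_level k p).le k.le_succ]
    simp only [rise]
    rw [levelStep_eq_one hx, h1]
    ring

lemma contDiffOn_potential (h : IsLevelApprox l g) :
    ContDiffOn ℝ (⊤ : ℕ∞) (potential g) {z | z.2 ∈ Ioo (0 : ℝ) 1} := by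
  rintro ⟨p, x⟩ ⟨hx0, hx1⟩
  obtain ⟨k, hk⟩ := (eventually_lt_level hx1).exists
  have he : potential g =ᶠ[𝓝 (p, x)] fun z => logCoef g z.1 * Real.log z.2 + rise g k z := by
    have : ∀ᶠ z : B × ℝ in 𝓝 (p, x), z.2 < level k :=
      continuous_snd.continuousAt.eventually_lt continuousAt_const hk
    filter_upwards [this] with z hz
    rw [potential, riseLim_eq hz.le]
  refine (ContDiffAt.congr_of_eventuallyEq ?_ he).contDiffWithinAt
  exact ((h.contDiff_logCoef.comp contDiff_fst).contDiffAt.mul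
    (contDiffAt_snd.log hx0.ne')).add (h.contDiff_rise k).contDiffAt

lemma fderiv_potential_pos (h : IsLevelApprox l g) (p : B) {x : ℝ} (hx : x ∈ Ioo (0 : ℝ) 1) :
    0 < fderiv ℝ (potential g) (p, x) (0, 1) := by
  obtain ⟨k, hk⟩ := (eventually_lt_level hx.2).exists
  have ho : IsOpen {z : B × ℝ | z.2 ∈ Ioo (0 : ℝ) 1} := isOpen_Ioo.preimage continuous_snd
  have hd : DifferentiableAt ℝ (potential g) (p, x) :=
    (h.contDiffOn_potential.contDiffAt (ho.mem_nhds hx)).differentiableAt (by simp)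
  have h1 : HasDerivAt (fun y => potential g (p, y)) (fderiv ℝ (potential g) (p, x) (0, 1)) x :=
    hd.hasFDerivAt.comp_hasDerivAt x ((hasDerivAt_const x p).prodMk (hasDerivAt_id x))
  have hr : DifferentiableAt ℝ (fun y => rise g k (p, y)) x :=
    ((h.contDiff_rise k).comp (contDiff_const.prodMk contDiff_id)).differentiable (by simp) x
  have h2 : HasDerivAt (fun y => logCoef g p * Real.log y + rise g k (p, y))
      (logCoef g p * x⁻¹ + deriv (fun y => rise g k (p, y)) x) x :=
    ((Real.hasDerivAt_log hx.1.ne').const_mul _).add hr.hasDerivAt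
  have he : (fun y => potential g (p, y)) =ᶠ[𝓝 x]
      fun y => logCoef g p * Real.log y + rise g k (p, y) := by
    filter_upwards [gt_mem_nhds hk] with y hy
    rw [potential, riseLim_eq (le_of_lt hy)]
  rw [h1.unique (h2.congr_of_eventuallyEq he)]
  have h3 := (h.rise_monotone k p).deriv_nonneg (x := x)
  have h4 := mul_pos (h.logCoef_pos p) (inv_pos.2 hx.1)
  linarith

lemma exists_potential_lt (h : IsLevelApprox l g) (p : B) (a : ℝ) :
    ∃ x ∈ Ioo (0 : ℝ) 1, potential g (p, x) < a := by
  have h1 : Tendsto (fun x => logCoef g p * Real.log x) (𝓝[>] 0) atBot :=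
    Real.tendsto_log_nhdsGT_zero.const_mul_atBot (h.logCoef_pos p)
  have h2 : ∀ᶠ x : ℝ in 𝓝[>] 0, x ∈ Ioo 0 (level 0) := Ioo_mem_nhdsGT (level_pos 0)
  obtain ⟨x, hxa, hx⟩ := ((h1.eventually_lt_atBot a).and h2).exists
  refine ⟨x, ⟨hx.1, hx.2.trans (level_lt_one 0)⟩, ?_⟩
  rw [potential, riseLim_eq hx.2.le]
  simpa [rise] using hxa

lemma potential_strictMonoOn (h : IsLevelApprox l g) (p : B) :
    StrictMonoOn (fun x => potential g (p, x)) (Ioo 0 1) := by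
  intro x hx y hy hxy
  have h1 : riseLim g (p, x) ≤ riseLim g (p, y) := by
    have hy' := le_level_ceil hy.2
    rw [riseLim_eq hy', riseLim_eq (hxy.le.trans hy')]
    exact h.rise_monotone _ p hxy.le
  have h2 := mul_lt_mul_of_pos_left (Real.log_lt_log hx.1 hxy) (h.logCoef_pos p)
  simp only [potential]
  linarith

lemma lt_iff_exists_potential (h : IsLevelApprox l g) (p : B) {x : ℝ} (hx : x ∈ Ioo (0 : ℝ) 1) :
    x < l p ↔ ∃ y ∈ Ioo (0 : ℝ) 1, potential g (p, x) + 1 < potential g (p, y) := by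
  have hmem : ∀ k, g k p ∈ Ioo (0 : ℝ) 1 := fun k => ⟨h.pos k p, h.lt_one k p⟩
  have hg : ∀ k, potential g (p, g k p) =
      logCoef g p * Real.log (g k p) + rise g k (p, g k p) := fun k => by
    rw [potential, riseLim_eq (h.lt_level k p).le]
  constructor
  · intro hxl
    obtain ⟨k, hk⟩ := h.exists_lt p x hxl
    have h1 : potential g (p, x) < potential g (p, g k p) :=
      h.potential_strictMonoOn p hx (hmem k) hk
    have h2 : Tendsto (fun y => logCoef g p * Real.log y) (𝓝[<] 1) (𝓝 0) := by
      have : ContinuousAt (fun y => logCoef g p * Real.log y) 1 :=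
        continuousAt_const.mul (Real.continuousAt_log one_ne_zero)
      have h3 := this.tendsto
      rw [Real.log_one, mul_zero] at h3
      exact h3.mono_left nhdsWithin_le_nhds
    have h3 : ∀ᶠ y : ℝ in 𝓝[<] 1, y ∈ Ioo (level k) 1 := Ioo_mem_nhdsLT (level_lt_one k)
    obtain ⟨y, hya, hy⟩ := ((h2.eventually_const_lt
      (show potential g (p, x) - potential g (p, g k p) < 0 by linarith)).and h3).exists
    refine ⟨y, ⟨(level_pos k).trans hy.1, hy.2⟩, ?_⟩
    have h4 := h.rise_le_riseLim k p hy.2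
    rw [h.rise_eq_of_ge k p hy.1.le] at h4
    have h5 := hg k
    have h6 : potential g (p, y) = logCoef g p * Real.log y + riseLim g (p, y) := rfl
    linarith
  · rintro ⟨y, hy, hxy⟩
    by_contra! hlx
    obtain ⟨k, hk⟩ := (eventually_lt_level hy.2).exists
    have h1 : potential g (p, y) < potential g (p, level k) :=
      h.potential_strictMonoOn p hy ⟨level_pos k, level_lt_one k⟩ hk
    have h2 : potential g (p, g k p) < potential g (p, x) :=
      h.potential_strictMonoOn p (hmem k) hx ((h.lt k p).trans_le hlx)
    have h3 : potential g (p, level k) =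
        logCoef g p * Real.log (level k) + rise g k (p, level k) := by
      rw [potential, riseLim_eq le_rfl]
    have h4 := mul_pos_of_neg_of_neg (neg_neg_of_pos (h.logCoef_pos p))
      (Real.log_neg (level_pos k) (level_lt_one k))
    rw [h.rise_eq_of_ge k p le_rfl] at h3
    have h5 := hg k
    linarith

end IsLevelApprox

end Potential

section Excision

open Filter Topology

lemma exists_hasDerivAt_inverse {h h' : ℝ → ℝ} (hm : StrictMonoOn h (Ioo 0 1))
    (hd : ∀ x ∈ Ioo (0 : ℝ) 1, HasDerivAt h (h' x) x) (h0 : ∀ x ∈ Ioo (0 : ℝ) 1, h' x ≠ 0)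
    {a b : ℝ} (ha : a ∈ Ioo (0 : ℝ) 1) (hb : b ∈ Ioo (0 : ℝ) 1) :
    ∃ G : ℝ → ℝ, ∀ s ∈ Ioo (h a) (h b),
      G s ∈ Ioo (0 : ℝ) 1 ∧ h (G s) = s ∧ HasDerivAt G (h' (G s))⁻¹ s := by
  have hsub : Icc a b ⊆ Ioo 0 1 := fun x hx => ⟨ha.1.trans_le hx.1, hx.2.trans_lt hb.2⟩
  have hc : ContinuousOn h (Icc a b) := fun x hx => (hd x (hsub hx)).continuousAt.continuousWithinAt
  have hex : ∀ s, ∃ x, s ∈ Ioo (h a) (h b) → x ∈ Ioo a b ∧ h x = s := by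
    intro s
    by_cases hs : s ∈ Ioo (h a) (h b)
    · have hab : a ≤ b := (hm.lt_iff_lt ha hb).1 (hs.1.trans hs.2) |>.le
      obtain ⟨x, hx, hxs⟩ := intermediate_value_Ioo hab hc hs
      exact ⟨x, fun _ => ⟨hx, hxs⟩⟩
    · exact ⟨0, fun h => absurd h hs⟩
  choose G hG using hex
  have hG1 : ∀ s ∈ Ioo (h a) (h b), G s ∈ Ioo (0 : ℝ) 1 := fun s hs =>
    hsub (Ioo_subset_Icc_self (hG s hs).1)
  have hGm : StrictMonoOn G (Ioo (h a) (h b)) := fun s hs t ht hst => by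
    rw [← hm.lt_iff_lt (hG1 s hs) (hG1 t ht), (hG s hs).2, (hG t ht).2]
    exact hst
  refine ⟨G, fun s hs => ⟨hG1 s hs, (hG s hs).2, ?_⟩⟩
  have hns : Ioo (h a) (h b) ∈ 𝓝 s := isOpen_Ioo.mem_nhds hs
  refine HasDerivAt.of_local_left_inverse ?_ (hd _ (hG1 s hs)) (h0 _ (hG1 s hs)) ?_
  · refine hGm.continuousAt_of_image_mem_nhds hns ?_
    refine mem_of_superset (isOpen_Ioo.mem_nhds (hG s hs).1) fun x hx => ?_
    have hx1 := hsub (Ioo_subset_Icc_self hx)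
    have hxs : h x ∈ Ioo (h a) (h b) := ⟨hm ha hx1 hx.1, hm hx1 hb hx.2⟩
    exact ⟨h x, hxs, hm.injOn (hG1 _ hxs) hx1 (hG _ hxs).2⟩
  · filter_upwards [hns] with t ht using (hG t ht).2

variable {m : ℕ}

/-- The reciprocal of the derivative of the potential in the last direction. -/
def slopeInv (g : ℕ → (Fin m → ℝ) × (Fin m → ℝ) → ℝ) (z : EE m) : ℝ :=
  (fderiv ℝ (potential g) (z.1, z.2.1) (0, 1))⁻¹

/-- An exhausting function of `Mset m`. -/
def exhaustion (z : EE m) : ℝ :=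
  1 + (∑ i, (z.1.1 i ^ 2 + z.1.2 i ^ 2)) + 1 / (z.2.1 * (1 - z.2.1)) + z.2.2 ^ 2

/-- The Hamiltonian whose time-one flow performs the excision. -/
def excisionHam (g : ℕ → (Fin m → ℝ) × (Fin m → ℝ) → ℝ) (z : EE m) : ℝ :=
  z.2.2 * (slopeInv g z / (1 + (exhaustion z * (z.2.2 * slopeInv g z)) ^ 2))

lemma isOpen_Mset : IsOpen (Mset m) :=
  isOpen_Ioo.preimage (continuous_fst.comp continuous_snd)

lemma exhaustion_pos {z : EE m} (hz : z ∈ Mset m) : 0 < exhaustion z := by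
  have h1 : 0 < z.2.1 := hz.1
  have h2 : 0 < 1 - z.2.1 := sub_pos.2 hz.2
  have h3 : 0 ≤ ∑ i, (z.1.1 i ^ 2 + z.1.2 i ^ 2) := Finset.sum_nonneg fun i _ => by positivity
  unfold exhaustion
  positivity

lemma contDiffOn_exhaustion : ContDiffOn ℝ (⊤ : ℕ∞) (exhaustion (m := m)) (Mset m) := by
  have h1 : ContDiffOn ℝ (⊤ : ℕ∞) (fun z : EE m => 1 / (z.2.1 * (1 - z.2.1))) (Mset m) :=
    contDiffOn_const.div (by fun_prop) fun z hz => (mul_pos hz.1 (sub_pos.2 hz.2)).ne'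
  have h2 : ContDiff ℝ (⊤ : ℕ∞) fun z : EE m => 1 + ∑ i, (z.1.1 i ^ 2 + z.1.2 i ^ 2) := by
    fun_prop
  have h3 : ContDiff ℝ (⊤ : ℕ∞) fun z : EE m => z.2.2 ^ 2 := by fun_prop
  exact (h2.contDiffOn.add h1).add h3.contDiffOn

/-- A level set on which the exhaustion is bounded is compact. -/
lemma isCompact_inter_level {F : EE m → ℝ} (hF : ContinuousOn F (Mset m)) {c R : ℝ}
    (hR : ∀ z ∈ Mset m, F z = c → exhaustion z ≤ R) : IsCompact {z ∈ Mset m | F z = c} := by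
  rcases eq_empty_or_nonempty {z ∈ Mset m | F z = c} with he | ⟨z₀, hz₀, hz₀'⟩
  · rw [he]; exact isCompact_empty
  have hsq : ∀ z ∈ Mset m, 0 ≤ ∑ i, (z.1.1 i ^ 2 + z.1.2 i ^ 2) := fun z _ =>
    Finset.sum_nonneg fun i _ => by positivity
  have hq : ∀ z ∈ Mset m, 0 < 1 / (z.2.1 * (1 - z.2.1)) := fun z hz =>
    one_div_pos.2 (mul_pos hz.1 (sub_pos.2 hz.2))
  have hR1 : 1 ≤ R := by
    have h1 := hR _ hz₀ hz₀'
    have h2 := hsq _ hz₀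
    have h3 := hq _ hz₀
    unfold exhaustion at h1
    nlinarith [sq_nonneg z₀.2.2]
  have hR0 : 0 < R := by linarith
  have habs : ∀ t : ℝ, 1 + t ^ 2 ≤ R → t ∈ Icc (-R) R := fun t ht => by
    constructor <;> nlinarith [sq_nonneg (t - 1), sq_nonneg (t + 1)]
  let K : Set (EE m) := (Icc (fun _ => -R) (fun _ => R) ×ˢ Icc (fun _ => -R) (fun _ => R)) ×ˢ
    (Icc (1 / R) (1 - 1 / R) ×ˢ Icc (-R) R)
  have hK : IsCompact K := (isCompact_Icc.prod isCompact_Icc).prod (isCompact_Icc.prod isCompact_Icc)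
  have hKM : K ⊆ Mset m := fun z hz => by
    have h1 : 1 / R ≤ z.2.1 := hz.2.1.1
    have h2 : z.2.1 ≤ 1 - 1 / R := hz.2.1.2
    have h3 : 0 < 1 / R := by positivity
    exact ⟨by linarith, by linarith⟩
  have hSK : {z ∈ Mset m | F z = c} = K ∩ F ⁻¹' {c} := by
    ext z
    refine ⟨fun ⟨hz, hzc⟩ => ⟨?_, hzc⟩, fun hz => ⟨hKM hz.1, hz.2⟩⟩
    have h1 := hR z hz hzc
    have h2 := hsq z hz
    have h3 := hq z hz
    have h4 : 0 < z.2.1 := hz.1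
    have h5 : z.2.1 < 1 := hz.2
    unfold exhaustion at h1
    have hi : ∀ i, z.1.1 i ^ 2 + z.1.2 i ^ 2 ≤ ∑ i, (z.1.1 i ^ 2 + z.1.2 i ^ 2) := fun i =>
      Finset.single_le_sum (f := fun i => z.1.1 i ^ 2 + z.1.2 i ^ 2)
        (fun j _ => by positivity) (Finset.mem_univ i)
    have hi1 : ∀ i, z.1.1 i ∈ Icc (-R) R := fun i =>
      habs _ (by nlinarith [hi i, sq_nonneg (z.1.2 i), sq_nonneg z.2.2])
    have hi2 : ∀ i, z.1.2 i ∈ Icc (-R) R := fun i =>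
      habs _ (by nlinarith [hi i, sq_nonneg (z.1.1 i), sq_nonneg z.2.2])
    have h6 : 1 / R ≤ z.2.1 * (1 - z.2.1) := by
      rw [one_div_le hR0 (mul_pos h4 (by linarith))]
      nlinarith [sq_nonneg z.2.2]
    refine ⟨⟨⟨fun i => (hi1 i).1, fun i => (hi1 i).2⟩, ⟨fun i => (hi2 i).1, fun i => (hi2 i).2⟩⟩,
      ⟨?_, ?_⟩, habs _ (by linarith)⟩
    · nlinarith
    · nlinarith
  rw [hSK]
  exact hK.of_isClosed_subset ((hF.mono hKM).preimage_isClosed_of_isClosed hK.isClosed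
    isClosed_singleton) inter_subset_left

namespace IsLevelApprox

variable {l : (Fin m → ℝ) × (Fin m → ℝ) → ℝ} {g : ℕ → (Fin m → ℝ) × (Fin m → ℝ) → ℝ}

lemma slopeInv_pos (h : IsLevelApprox l g) {z : EE m} (hz : z ∈ Mset m) : 0 < slopeInv g z :=
  inv_pos.2 (h.fderiv_potential_pos z.1 hz)

lemma contDiffOn_slopeInv (h : IsLevelApprox l g) : ContDiffOn ℝ (⊤ : ℕ∞) (slopeInv g) (Mset m) := by
  have ho : IsOpen {z : ((Fin m → ℝ) × (Fin m → ℝ)) × ℝ | z.2 ∈ Ioo (0 : ℝ) 1} :=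
    isOpen_Ioo.preimage continuous_snd
  have h1 : ContDiffOn ℝ (⊤ : ℕ∞) (fderiv ℝ (potential g))
      {z : ((Fin m → ℝ) × (Fin m → ℝ)) × ℝ | z.2 ∈ Ioo (0 : ℝ) 1} :=
    h.contDiffOn_potential.fderiv_of_isOpen ho (by simp)
  have h2 : ContDiffOn ℝ (⊤ : ℕ∞)
      (fun z : EE m => fderiv ℝ (potential g) (z.1, z.2.1)) (Mset m) :=
    h1.comp (f := fun z : EE m => (z.1, z.2.1)) (by fun_prop) fun z hz => hz
  exact (h2.clm_apply contDiffOn_const).inv fun z hz => (h.fderiv_potential_pos z.1 hz).ne'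

lemma contDiffOn_coef (h : IsLevelApprox l g) : ContDiffOn ℝ (⊤ : ℕ∞)
    (fun z : EE m => slopeInv g z / (1 + (exhaustion z * (z.2.2 * slopeInv g z)) ^ 2)) (Mset m) := by
  have h1 : ContDiffOn ℝ (⊤ : ℕ∞) (fun z : EE m => z.2.2) (Mset m) := by fun_prop
  exact h.contDiffOn_slopeInv.div (contDiffOn_const.add
    ((contDiffOn_exhaustion.mul (h1.mul h.contDiffOn_slopeInv)).pow 2)) fun z _ => by positivity

lemma contDiffOn_excisionHam (h : IsLevelApprox l g) :
    ContDiffOn ℝ (⊤ : ℕ∞) (excisionHam g) (Mset m) := by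
  have h1 : ContDiffOn ℝ (⊤ : ℕ∞) (fun z : EE m => z.2.2) (Mset m) := by fun_prop
  exact h1.mul h.contDiffOn_coef

lemma excisionHam_eq_zero_iff (h : IsLevelApprox l g) {z : EE m} (hz : z ∈ Mset m) :
    excisionHam g z = 0 ↔ z.2.2 = 0 := by
  have : slopeInv g z / (1 + (exhaustion z * (z.2.2 * slopeInv g z)) ^ 2) ≠ 0 :=
    (div_pos (h.slopeInv_pos hz) (by positivity)).ne'
  rw [excisionHam, mul_eq_zero, or_iff_left this]

lemma exhaustion_mul_abs_le {z : EE m} (hz : z ∈ Mset m) :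
    exhaustion z * |excisionHam g z| ≤ 1 := by
  have h1 := exhaustion_pos hz
  have h2 : exhaustion z * |excisionHam g z| = |exhaustion z * (z.2.2 * slopeInv g z)| /
      (1 + (exhaustion z * (z.2.2 * slopeInv g z)) ^ 2) := by
    rw [excisionHam, ← mul_div_assoc, abs_div, abs_mul (exhaustion z), abs_of_pos h1,
      abs_of_pos (a := 1 + _) (by positivity), mul_div_assoc]
  rw [h2, div_le_one (by positivity), ← sq_abs]
  nlinarith [sq_nonneg (|exhaustion z * (z.2.2 * slopeInv g z)| - 1)]

lemma isCompact_level (h : IsLevelApprox l g) {z : EE m} (hz : z ∈ Mset m) (hy : z.2.2 ≠ 0) :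
    IsCompact {w ∈ Mset m | excisionHam g w = excisionHam g z} := by
  refine isCompact_inter_level h.contDiffOn_excisionHam.continuousOn
    (R := 1 / |excisionHam g z|) fun w hw hwz => ?_
  rw [le_div_iff₀ (abs_pos.2 fun h0 => hy ((h.excisionHam_eq_zero_iff hz).1 h0)), ← hwz]
  exact exhaustion_mul_abs_le hw

lemma hamVF_excisionHam (h : IsLevelApprox l g) {z : EE m} (hz : z ∈ Mset m) (hy : z.2.2 = 0) :
    hamVF (excisionHam g) z = (0, (slopeInv g z, 0)) := by
  have h1 : HasFDerivAt (fun w : EE m => w.2.2)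
      ((ContinuousLinearMap.snd ℝ ℝ ℝ).comp (ContinuousLinearMap.snd ℝ _ (ℝ × ℝ))) z :=
    ((ContinuousLinearMap.snd ℝ ℝ ℝ).comp
      (ContinuousLinearMap.snd ℝ ((Fin m → ℝ) × (Fin m → ℝ)) (ℝ × ℝ))).hasFDerivAt
  have h2 := ((h.contDiffOn_coef.contDiffAt (isOpen_Mset.mem_nhds hz)).differentiableAt
    (by simp)).hasFDerivAt
  have h3 : HasFDerivAt (excisionHam g) _ z := h1.mul h2
  rw [hamVF, h3.fderiv, sharp_apply]
  ext i <;> simp [hy]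

lemma hasDerivAt_potential (h : IsLevelApprox l g) (p : (Fin m → ℝ) × (Fin m → ℝ)) {x : ℝ}
    (hx : x ∈ Ioo (0 : ℝ) 1) : HasDerivAt (fun y => potential g (p, y))
      (fderiv ℝ (potential g) (p, x) (0, 1)) x := by
  have ho : IsOpen {z : ((Fin m → ℝ) × (Fin m → ℝ)) × ℝ | z.2 ∈ Ioo (0 : ℝ) 1} :=
    isOpen_Ioo.preimage continuous_snd
  exact ((h.contDiffOn_potential.contDiffAt (ho.mem_nhds hx)).differentiableAt
    (by simp)).hasFDerivAt.comp_hasDerivAt x ((hasDerivAt_const x p).prodMk (hasDerivAt_id x))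

lemma exists_flowsTo (h : IsLevelApprox l g) {p : (Fin m → ℝ) × (Fin m → ℝ)} {x : ℝ}
    (hx : x ∈ Ioo (0 : ℝ) 1) (hxl : x < l p) :
    ∃ x' ∈ Ioo (0 : ℝ) 1, potential g (p, x') = potential g (p, x) + 1 ∧
      FlowsTo (Mset m) (hamVF (excisionHam g)) (p, (x, 0)) (p, (x', 0)) := by
  obtain ⟨b, hb, hxb⟩ := (h.lt_iff_exists_potential p hx).1 hxl
  obtain ⟨a, ha, hax⟩ := h.exists_potential_lt p (potential g (p, x))
  have hm := h.potential_strictMonoOn p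
  obtain ⟨G, hG⟩ := exists_hasDerivAt_inverse hm (fun x hx => h.hasDerivAt_potential p hx)
    (fun x hx => (h.fderiv_potential_pos p hx).ne') ha hb
  have hmem : ∀ t ∈ Icc (0 : ℝ) 1, potential g (p, x) + t ∈
      Ioo (potential g (p, a)) (potential g (p, b)) := fun t ht =>
    ⟨by linarith [ht.1], by linarith [ht.2]⟩
  have h1 := hG _ (hmem 1 (by simp))
  have h0 := hG _ (hmem 0 (by simp))
  refine ⟨G (potential g (p, x) + 1), h1.1, h1.2.1,
    fun t => (p, (G (potential g (p, x) + t), 0)), ?_, fun t ht => ?_, rfl⟩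
  · have : G (potential g (p, x)) = x := by simpa using hm.injOn h0.1 hx (by simpa using h0.2.1)
    simp [this]
  · have ht' := hG _ (hmem t ht)
    have hM : ((p, (G (potential g (p, x) + t), 0)) : EE m) ∈ Mset m := ht'.1
    refine ⟨hM, ?_⟩
    rw [h.hamVF_excisionHam hM rfl]
    exact (hasDerivAt_const t p).prodMk ((ht'.2.2.comp_const_add _ t).prodMk (hasDerivAt_const t 0))

lemma exists_flowsTo_forward (h : IsLevelApprox l g) {z : EE m} (hz : z ∈ Mset m)
    (hzl : z.2.2 = 0 → z.2.1 < l z.1) :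
    ∃ w, FlowsTo (Mset m) (hamVF (excisionHam g)) z w := by
  by_cases hy : z.2.2 = 0
  · obtain ⟨x', -, -, h1⟩ := h.exists_flowsTo hz (hzl hy)
    rw [← hy] at h1
    exact ⟨_, h1⟩
  · obtain ⟨γ, rfl, hγ⟩ := exists_complete_trajectory isOpen_Mset h.contDiffOn_excisionHam
      (h.isCompact_level hz hy) hz
    exact ⟨_, FlowsTo.of_hasDerivAt (fun t => ⟨(hγ t).1, (hγ t).2.2⟩) 0⟩

lemma exists_flowsTo_backward (h : IsLevelApprox l g) {w : EE m} (hw : w ∈ Mset m) :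
    ∃ z ∈ Mset m, (z.2.2 = 0 → z.2.1 < l z.1) ∧
      FlowsTo (Mset m) (hamVF (excisionHam g)) z w := by
  by_cases hy : w.2.2 = 0
  · obtain ⟨p, x, y⟩ := w
    obtain rfl : y = 0 := hy
    have hx : x ∈ Ioo (0 : ℝ) 1 := hw
    have hm := h.potential_strictMonoOn p
    obtain ⟨a, ha, hax⟩ := h.exists_potential_lt p (potential g (p, x) - 1)
    have hlt : a < x := (hm.lt_iff_lt ha hx).1 (by linarith)
    obtain ⟨x', hx', hxx⟩ := intermediate_value_Icc hlt.le
      (f := fun x => potential g (p, x)) (fun t ht => (h.hasDerivAt_potential p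
        ⟨ha.1.trans_le ht.1, ht.2.trans_lt hx.2⟩).continuousAt.continuousWithinAt)
      (show potential g (p, x) - 1 ∈ _ from ⟨hax.le, by linarith⟩)
    have hx'1 : x' ∈ Ioo (0 : ℝ) 1 := ⟨ha.1.trans_le hx'.1, hx'.2.trans_lt hx.2⟩
    obtain ⟨y', hxy, hy'⟩ := exists_between hx.2
    have h1 : potential g (p, x) < potential g (p, y') := hm hx ⟨hx.1.trans hxy, hy'⟩ hxy
    have hxx' : potential g (p, x') = potential g (p, x) - 1 := hxx
    have h2 : x' < l p := (h.lt_iff_exists_potential p hx'1).2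
      ⟨y', ⟨hx.1.trans hxy, hy'⟩, by linarith⟩
    obtain ⟨x'', hx'', he, hfl⟩ := h.exists_flowsTo hx'1 h2
    obtain rfl : x'' = x := hm.injOn hx'' hx (show potential g (p, x'') = potential g (p, x) by
      linarith)
    exact ⟨_, hx'1, fun _ => h2, hfl⟩
  · obtain ⟨γ, h0, hγ⟩ := exists_complete_trajectory isOpen_Mset h.contDiffOn_excisionHam
      (h.isCompact_level hw hy) hw
    refine ⟨γ (-1), (hγ _).1, fun h1 => absurd ?_ hy, ?_⟩
    · rw [← h.excisionHam_eq_zero_iff hw, ← (hγ (-1)).2.1, h.excisionHam_eq_zero_iff (hγ _).1]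
      exact h1
    · simpa [h0] using FlowsTo.of_hasDerivAt (M := Mset m) (X := hamVF (excisionHam g))
        (fun t => ⟨(hγ t).1, (hγ t).2.2⟩) (-1)

lemma trajectory_of_snd_eq_zero (h : IsLevelApprox l g) {γ : ℝ → EE m} {T : ℝ}
    (h0 : (γ 0).2.2 = 0)
    (hγ : ∀ t ∈ Icc 0 T, γ t ∈ Mset m ∧ HasDerivAt γ (hamVF (excisionHam g) (γ t)) t) {t : ℝ}
    (ht : t ∈ Icc 0 T) : (γ t).1 = (γ 0).1 ∧ (γ 0).2.1 ≤ (γ t).2.1 ∧ (γ t).2.2 = 0 := by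
  have hT : (0 : ℝ) ∈ Icc 0 T := ⟨le_rfl, ht.1.trans ht.2⟩
  have hF : ∀ s ∈ Icc 0 T, HasDerivAt (fun s => excisionHam g (γ s)) 0 s := fun s hs => by
    have h1 := ((h.contDiffOn_excisionHam.contDiffAt
      (isOpen_Mset.mem_nhds (hγ s hs).1)).differentiableAt (by simp)).hasFDerivAt
    have h2 := h1.comp_hasDerivAt s (hγ s hs).2
    rwa [fderiv_hamVF_self] at h2
  have hy : ∀ s ∈ Icc 0 T, (γ s).2.2 = 0 := fun s hs => by
    have h1 := constant_of_has_deriv_right_zero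
      (fun s hs => (hF s hs).continuousAt.continuousWithinAt)
      (fun s hs => (hF s (Ico_subset_Icc_self hs)).hasDerivWithinAt) s hs
    rw [← h.excisionHam_eq_zero_iff (hγ s hs).1]
    exact h1.trans ((h.excisionHam_eq_zero_iff (hγ 0 hT).1).2 h0)
  have hd : ∀ s ∈ Icc 0 T, HasDerivAt γ (0, (slopeInv g (γ s), 0)) s := fun s hs => by
    rw [← h.hamVF_excisionHam (hγ s hs).1 (hy s hs)]
    exact (hγ s hs).2
  have hp : ∀ s ∈ Icc 0 T, HasDerivAt (fun s => (γ s).1) 0 s := fun s hs =>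
    (ContinuousLinearMap.fst ℝ ((Fin m → ℝ) × (Fin m → ℝ)) (ℝ × ℝ)).hasFDerivAt.comp_hasDerivAt s
      (hd s hs)
  have hx : ∀ s ∈ Icc 0 T, HasDerivAt (fun s => (γ s).2.1) (slopeInv g (γ s)) s := fun s hs =>
    ((ContinuousLinearMap.fst ℝ ℝ ℝ).comp (ContinuousLinearMap.snd ℝ
      ((Fin m → ℝ) × (Fin m → ℝ)) (ℝ × ℝ))).hasFDerivAt.comp_hasDerivAt s (hd s hs)
  refine ⟨?_, ?_, hy t ht⟩
  · exact constant_of_has_deriv_right_zero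
      (fun s hs => (hp s hs).continuousAt.continuousWithinAt)
      (fun s hs => (hp s (Ico_subset_Icc_self hs)).hasDerivWithinAt) t ht
  · refine monotoneOn_of_deriv_nonneg (f := fun s => (γ s).2.1) (convex_Icc 0 T)
      (fun s hs => (hx s hs).continuousAt.continuousWithinAt)
      (fun s hs => (hx s (interior_subset hs)).differentiableAt.differentiableWithinAt)
      (fun s hs => ?_) hT ht ht.1
    rw [(hx s (interior_subset hs)).deriv]
    exact (h.slopeInv_pos (hγ s (interior_subset hs)).1).le

end IsLevelApprox

lemma isOpen_strictSubgraph_union {l : (Fin m → ℝ) × (Fin m → ℝ) → ℝ}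
    (hl : LowerSemicontinuous l) : IsOpen {z : EE m | z ∈ Mset m ∧ (z.2.2 = 0 → z.2.1 < l z.1)} := by
  have h1 : IsOpen {z : EE m | z.2.1 < l z.1} := by
    rw [isOpen_iff_mem_nhds]
    intro z hz
    obtain ⟨c, hc1, hc2⟩ := exists_between (show z.2.1 < l z.1 from hz)
    have h2 : ∀ᶠ w : EE m in 𝓝 z, c < l w.1 := continuous_fst.continuousAt.eventually (hl z.1 c hc2)
    have h3 : ∀ᶠ w : EE m in 𝓝 z, w.2.1 < c :=
      (continuous_fst.comp continuous_snd).continuousAt.eventually_lt continuousAt_const hc1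
    filter_upwards [h2, h3] with w hw hw' using hw'.trans hw
  have h2 : IsOpen {z : EE m | z.2.2 ≠ 0} :=
    isOpen_ne.preimage (continuous_snd.comp continuous_snd)
  have h3 : {z : EE m | z ∈ Mset m ∧ (z.2.2 = 0 → z.2.1 < l z.1)} =
      Mset m ∩ ({z | z.2.2 ≠ 0} ∪ {z | z.2.1 < l z.1}) := by
    ext z
    simp only [mem_ofPred_eq, mem_inter_iff, mem_union, imp_iff_not_or, ne_eq]
  rw [h3]
  exact isOpen_Mset.inter (h2.union h1)

end Excision

/-- Let `l : ℝ^{2n-2} → (0,1]` be lower semi-continuous and let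
`Z = {(p, x, 0) ∈ M : l p ≤ x}` inside `M = ℝ^{2n-2} × (0,1) × ℝ` (the epigraph of `l`
times `{0}`).  Then `Z` is time-independent Hamiltonian excisable from `(M, ω_can)`:
there is a smooth `F : M → ℝ` whose Hamiltonian vector field `X = X_F` (characterized on
`M` by `ω_can(X z, w) = dF_z w`) has: forward trajectories starting in `Z` stay in `Z`
as long as they are defined; trajectories starting in `M ∖ Z` are defined (in `M`) at
least on `[0,1]`; and the time-1 flow map `φ` is a symplectomorphism from `M ∖ Z`
onto `M`. -/
theorem lsc_epigraph_timeIndependent_hamiltonian_excisable (m : ℕ)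
    (l : (Fin m → ℝ) × (Fin m → ℝ) → ℝ) (hl : LowerSemicontinuous l)
    (hl_range : ∀ p, l p ∈ Ioc (0 : ℝ) 1)
    (Z : Set (EE m))
    (hZ : Z = {z : EE m | z ∈ Mset m ∧ l z.1 ≤ z.2.1 ∧ z.2.2 = 0}) :
    ∃ F : EE m → ℝ, ContDiffOn ℝ (⊤ : ℕ∞) F (Mset m) ∧
    ∃ X : EE m → EE m,
      (∀ z ∈ Mset m, ∀ w, wcan m (X z) w = fderiv ℝ F z w) ∧
      (∀ (γ : ℝ → EE m) (T : ℝ), 0 ≤ T → γ 0 ∈ Z →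
        (∀ t ∈ Icc 0 T, γ t ∈ Mset m ∧ HasDerivAt γ (X (γ t)) t) →
        ∀ t ∈ Icc 0 T, γ t ∈ Z) ∧
      ∃ φ : EE m → EE m,
        (∀ z ∈ Mset m \ Z, ∃ γ : ℝ → EE m, γ 0 = z ∧
          (∀ t ∈ Icc (0:ℝ) 1, γ t ∈ Mset m ∧ HasDerivAt γ (X (γ t)) t) ∧ γ 1 = φ z) ∧
        ContDiffOn ℝ (⊤ : ℕ∞) φ (Mset m \ Z) ∧
        BijOn φ (Mset m \ Z) (Mset m) ∧
        (∃ ψ : EE m → EE m, ContDiffOn ℝ (⊤ : ℕ∞) ψ (Mset m) ∧ InvOn ψ φ (Mset m \ Z) (Mset m)) ∧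
        (∀ z ∈ Mset m \ Z, ∀ u v,
          wcan m (fderiv ℝ φ z u) (fderiv ℝ φ z v) = wcan m u v) := by
  obtain ⟨g, hg⟩ := exists_contDiff_approx hl (fun p => (hl_range p).1) fun p => (hl_range p).2
  have hN : Mset m \ Z = {z : EE m | z ∈ Mset m ∧ (z.2.2 = 0 → z.2.1 < l z.1)} := by
    ext z
    simp only [hZ, mem_sdiff, mem_ofPred_eq, ← not_le]
    tauto
  refine ⟨excisionHam g, hg.contDiffOn_excisionHam, hamVF (excisionHam g),
    fun z _ w => wcan_hamVF _ z w, fun γ T _ h0 hγ t ht => ?_, ?_⟩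
  · rw [hZ] at h0 ⊢
    obtain ⟨h1, h2, h3⟩ := hg.trajectory_of_snd_eq_zero h0.2.2 hγ ht
    exact ⟨(hγ t ht).1, h1 ▸ h0.2.1.trans h2, h3⟩
  · rw [hN]
    exact exists_timeOne_symplectomorphism isOpen_Mset (isOpen_strictSubgraph_union hl)
      hg.contDiffOn_excisionHam (fun z hz => hg.exists_flowsTo_forward hz.1 hz.2)
      fun w hw => (hg.exists_flowsTo_backward hw).imp fun z hz => ⟨⟨hz.1, hz.2.1⟩, hz.2.2⟩
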